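/- arXiv:2603.10439 — 3 statements merged into one kernel-verified Lean document; each statement's English description precedes it below -/
import Mathlib

section
/- Let m, n be natural numbers and let p and q be real polynomials with deg p ≤ m and deg q ≤ n, not both identically zero. Then the function I(k) = p(k)·K(k) + q(k)·E(k) has at most m + n + 2 zeros in the open interval (−1,1), counted with multiplicity. -/
/-- Complete elliptic integral of the first kind. -/
noncomputable def Kc (k : ℝ) : ℝ :=
  ∫ z in (0:ℝ)..1, 1 / Real.sqrt ((1 - z ^ 2) * (1 - k ^ 2 * z ^ 2))

/-- Complete elliptic integral of the second kind. -/
noncomputable def Ec (k : ℝ) : ℝ :=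
  ∫ z in (0:ℝ)..1, Real.sqrt (1 - k ^ 2 * z ^ 2) / Real.sqrt (1 - z ^ 2)

/-- Multiplicity (order of vanishing) of a zero of a real function. -/
noncomputable def zeroMult (φ : ℝ → ℝ) (x : ℝ) : ℕ :=
  sInf {n : ℕ | iteratedDeriv n φ x ≠ 0}

open MeasureTheory Set Filter Topology Polynomial
open scoped CompactlySupported

/-- The Schwarz-type formula recovering the real part of `g` on the real axis from its imaginary
part on a circle. -/
theorem average_im_mul_kernel_eq {g : ℂ → ℂ} (hg : DifferentiableOn ℂ g (Metric.ball 0 1))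
    {ρ s : ℝ} (hρ : 0 < ρ) (hρ1 : ρ < 1) (hs : s ∈ Ioo (-1 : ℝ) 1) :
    (2 * Real.pi)⁻¹ * ∫ θ in 0..2 * Real.pi, (g (circleMap 0 ρ θ)).im *
      (2 * Real.sin θ * (s / (1 - 2 * Real.cos θ * s + s ^ 2)))
      = (g ((ρ * s : ℝ) : ℂ)).re - (g 0).re := by
  have hs1 : |s| < 1 := abs_lt.2 hs
  have hdc : DiffContOnCl ℂ g (Metric.ball 0 |ρ|) := by
    apply DifferentiableOn.diffContOnCl
    apply hg.mono
    rw [abs_of_pos hρ, closure_ball _ hρ.ne']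
    exact Metric.closedBall_subset_ball hρ1
  have hw : ((ρ * s : ℝ) : ℂ) ∈ Metric.ball (0 : ℂ) |ρ| := by
    rw [mem_ball_zero_iff, Complex.norm_real, Real.norm_eq_abs, abs_mul]
    nlinarith [abs_pos.2 hρ.ne']
  have hne : ∀ z ∈ Metric.closedBall (0 : ℂ) ρ, (ρ : ℂ) - s * z ≠ 0 := by
    intro z hz h
    have h1 : (ρ : ℂ) = s * z := sub_eq_zero.1 h
    have h2 := congrArg norm h1
    rw [norm_mul, Complex.norm_real, Complex.norm_real, Real.norm_eq_abs, Real.norm_eq_abs,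
      abs_of_pos hρ] at h2
    have hz' : ‖z‖ ≤ ρ := by simpa using hz
    nlinarith [norm_nonneg z, abs_nonneg s]
  have hdc2 : DiffContOnCl ℂ (fun z => ((ρ : ℂ) / (ρ - s * z)) * g z) (Metric.ball 0 |ρ|) := by
    apply DifferentiableOn.diffContOnCl
    rw [abs_of_pos hρ, closure_ball _ hρ.ne']
    refine DifferentiableOn.mul ?_ (hg.mono (Metric.closedBall_subset_ball hρ1))
    exact DifferentiableOn.div (by fun_prop) (by fun_prop) hne
  have e1 := hdc.circleAverage_smul_div hw
  have e2 := hdc2.circleAverage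
  rw [Real.circleAverage_def] at e1 e2
  have hcm : ∀ θ, circleMap 0 ρ θ ∈ Metric.closedBall (0 : ℂ) ρ := fun θ =>
    circleMap_mem_closedBall _ hρ.le _
  have hgc : Continuous fun θ => g (circleMap 0 ρ θ) := by
    refine hg.continuousOn.comp_continuous (continuous_circleMap 0 ρ) fun θ => ?_
    exact Metric.closedBall_subset_ball hρ1 (hcm θ)
  have hne' : ∀ θ, circleMap 0 ρ θ - ((ρ * s : ℝ) : ℂ) ≠ 0 := by
    intro θ h
    have h2 := congrArg norm (sub_eq_zero.1 h)
    rw [norm_circleMap_zero, Complex.norm_real, Real.norm_eq_abs, abs_mul] at h2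
    nlinarith [abs_pos.2 hρ.ne']
  have c1 : Continuous fun θ => ((circleMap 0 ρ θ - 0) / (circleMap 0 ρ θ - ((ρ * s : ℝ) : ℂ))) •
      g (circleMap 0 ρ θ) :=
    (((continuous_circleMap 0 ρ).sub continuous_const).div
      ((continuous_circleMap 0 ρ).sub continuous_const) hne').smul hgc
  have c2 : Continuous fun θ => ((ρ : ℂ) / (ρ - s * circleMap 0 ρ θ)) * g (circleMap 0 ρ θ) :=
    (continuous_const.div (continuous_const.sub (continuous_const.mul (continuous_circleMap 0 ρ)))
      fun θ => hne _ (hcm θ)).mul hgc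
  have e3 : ((2 * Real.pi)⁻¹ : ℝ) • ∫ θ in 0..2 * Real.pi,
      (((circleMap 0 ρ θ - 0) / (circleMap 0 ρ θ - ((ρ * s : ℝ) : ℂ))) • g (circleMap 0 ρ θ) -
      ((ρ : ℂ) / (ρ - s * circleMap 0 ρ θ)) * g (circleMap 0 ρ θ)) =
      g ((ρ * s : ℝ) : ℂ) - g 0 := by
    rw [intervalIntegral.integral_sub (c1.intervalIntegrable _ _) (c2.intervalIntegrable _ _),
      smul_sub, e1, e2]
    simp [hρ.ne']
  have e4 := congrArg Complex.re e3
  rw [Complex.sub_re] at e4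
  rw [← e4, Complex.smul_re, smul_eq_mul]
  congr 1
  have : ∀ f : ℝ → ℂ, Continuous f → (∫ θ in 0..2 * Real.pi, f θ).re =
      ∫ θ in 0..2 * Real.pi, (f θ).re := fun f hf =>
    (Complex.reCLM.intervalIntegral_comp_comm (hf.intervalIntegrable _ _)).symm
  refine Eq.trans ?_ (this _ (c1.sub c2)).symm
  refine intervalIntegral.integral_congr fun θ _ => ?_
  have key : ((circleMap 0 ρ θ - 0) / (circleMap 0 ρ θ - ((ρ * s : ℝ) : ℂ))) -
      ((ρ : ℂ) / (ρ - s * circleMap 0 ρ θ)) =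
      -Complex.I * ((2 * Real.sin θ * (s / (1 - 2 * Real.cos θ * s + s ^ 2)) : ℝ) : ℂ) := by
    have h1 := hne' θ
    have h2 := hne _ (hcm θ)
    have h3 : (1 - 2 * Real.cos θ * s + s ^ 2) ≠ 0 := by
      have := Real.sin_sq_add_cos_sq θ
      have h4 : 1 - 2 * Real.cos θ * s + s ^ 2 = (s - Real.cos θ) ^ 2 + Real.sin θ ^ 2 := by
        nlinarith
      rw [h4]
      intro h0
      have h5 : Real.sin θ = 0 := by nlinarith [sq_nonneg (s - Real.cos θ), sq_nonneg (Real.sin θ)]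
      have h6 : s = Real.cos θ := by nlinarith [sq_nonneg (s - Real.cos θ), sq_nonneg (Real.sin θ)]
      have h7 : s ^ 2 = 1 := by rw [h6]; nlinarith
      nlinarith [hs.1, hs.2]
    have h3' : (1 - 2 * (Real.cos θ : ℂ) * s + (s : ℂ) ^ 2) ≠ 0 := by exact_mod_cast h3
    have hz : circleMap 0 ρ θ = ρ * (Real.cos θ + Real.sin θ * Complex.I) := by
      rw [circleMap, zero_add, Complex.exp_mul_I, Complex.ofReal_cos, Complex.ofReal_sin]
    have hcs : (Real.sin θ : ℂ) ^ 2 = 1 - (Real.cos θ : ℂ) ^ 2 := by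
      have := Real.sin_sq θ
      exact_mod_cast this
    push_cast at h1 ⊢
    rw [hz] at h1 h2 ⊢
    rw [← Complex.ofReal_cos, ← Complex.ofReal_sin]
    generalize (Real.cos θ : ℂ) = c at *
    generalize (Real.sin θ : ℂ) = t at *
    have hρ' : (ρ : ℂ) ≠ 0 := by exact_mod_cast hρ.ne'
    have h1' : c + t * Complex.I - s ≠ 0 := by
      intro h; apply h1; linear_combination (ρ : ℂ) * h
    have h2' : 1 - s * (c + t * Complex.I) ≠ 0 := by
      intro h; apply h2; linear_combination (ρ : ℂ) * h
    have f1 : (↑ρ * (c + t * Complex.I) - 0) / (↑ρ * (c + t * Complex.I) - ↑ρ * ↑s) =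
        (c + t * Complex.I) / (c + t * Complex.I - s) := by
      rw [sub_zero, ← mul_sub, mul_div_mul_left _ _ hρ']
    have f2 : (ρ : ℂ) / (ρ - s * (ρ * (c + t * Complex.I))) =
        1 / (1 - s * (c + t * Complex.I)) := by
      rw [div_eq_div_iff h2 h2']; ring
    rw [f1, f2, div_sub_div _ _ h1' h2', mul_div_assoc', mul_div_assoc',
      div_eq_div_iff (mul_ne_zero h1' h2') h3']
    have hI := Complex.I_sq
    have hζ : (c + t * Complex.I) ^ 2 = 2 * c * (c + t * Complex.I) - 1 := by
      linear_combination t ^ 2 * hI - hcs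
    linear_combination ((s:ℂ) * (1 - 2 * c * s + s ^ 2) - 2 * (s:ℂ) ^ 2 * (t * Complex.I)) * hζ
  simp only [smul_eq_mul, Pi.sub_apply]
  rw [← sub_mul, key]
  simp [-Complex.ofReal_mul, -Complex.ofReal_div]
  ring

theorem one_sub_two_mul_add_sq_pos {c s : ℝ} (hc : c ∈ Icc (-1 : ℝ) 1)
    (hs : s ∈ Ioo (-1 : ℝ) 1) : 0 < 1 - 2 * c * s + s ^ 2 := by
  obtain ⟨h1, h2⟩ := hc
  obtain ⟨h3, h4⟩ := hs
  rcases le_total 0 s with h | h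
  · nlinarith [mul_nonneg (sub_nonneg.2 h2) h, sq_pos_of_pos (sub_pos.2 h4)]
  · nlinarith [mul_nonneg (neg_le_iff_add_nonneg.1 h1) (neg_nonneg.2 h),
      sq_pos_of_pos (neg_lt_iff_pos_add.1 h3)]

/-- Integral representation of typically real functions on the unit disc. -/
theorem exists_measure_of_im_mul_im_nonneg {g : ℂ → ℂ}
    (hg : DifferentiableOn ℂ g (Metric.ball 0 1))
    (him : ∀ z ∈ Metric.ball (0 : ℂ) 1, 0 ≤ (g z).im * z.im) :
    ∃ μ : Measure (Icc (-1 : ℝ) 1), IsFiniteMeasure μ ∧ ∀ s ∈ Ioo (-1 : ℝ) 1,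
      (g s).re = (g 0).re + ∫ c, s / (1 - 2 * (c : ℝ) * s + s ^ 2) ∂μ := by
  let cs : ℝ → Icc (-1 : ℝ) 1 := fun θ => ⟨Real.cos θ, Real.cos_mem_Icc θ⟩
  have hcs : Continuous cs := Real.continuous_cos.subtype_mk _
  let L : ℝ → C_c(Icc (-1 : ℝ) 1, ℝ) → ℝ := fun ρ φ =>
    (2 * Real.pi)⁻¹ * ∫ θ in 0..2 * Real.pi, (g (circleMap 0 ρ θ)).im *
      (2 * Real.sin θ * φ (cs θ))
  have hball : ∀ ρ ∈ Ioo (0 : ℝ) 1, ∀ θ, circleMap 0 ρ θ ∈ Metric.ball (0 : ℂ) 1 := by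
    intro ρ hρ θ
    exact Metric.closedBall_subset_ball hρ.2 (circleMap_mem_closedBall _ hρ.1.le _)
  have hcont : ∀ ρ ∈ Ioo (0 : ℝ) 1, ∀ φ : C_c(Icc (-1 : ℝ) 1, ℝ),
      Continuous fun θ => (g (circleMap 0 ρ θ)).im * (2 * Real.sin θ * φ (cs θ)) := by
    intro ρ hρ φ
    have h1 : Continuous fun θ => g (circleMap 0 ρ θ) :=
      hg.continuousOn.comp_continuous (continuous_circleMap 0 ρ) (hball ρ hρ)
    have h2 : Continuous fun θ => φ (cs θ) := φ.continuous.comp hcs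
    exact (Complex.continuous_im.comp h1).mul ((by fun_prop : Continuous fun θ =>
      2 * Real.sin θ).mul h2)
  have hLadd : ∀ ρ ∈ Ioo (0 : ℝ) 1, ∀ φ ψ, L ρ (φ + ψ) = L ρ φ + L ρ ψ := by
    intro ρ hρ φ ψ
    simp only [L]
    rw [← mul_add, ← intervalIntegral.integral_add ((hcont ρ hρ φ).intervalIntegrable _ _)
      ((hcont ρ hρ ψ).intervalIntegrable _ _)]
    congr 1
    refine intervalIntegral.integral_congr fun θ _ => ?_
    simp only [CompactlySupportedContinuousMap.coe_add, Pi.add_apply]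
    ring
  have hLsmul : ∀ ρ, ∀ (a : ℝ) φ, L ρ (a • φ) = a * L ρ φ := by
    intro ρ a φ
    simp only [L]
    rw [mul_left_comm, ← intervalIntegral.integral_const_mul a]
    congr 1
    refine intervalIntegral.integral_congr fun θ _ => ?_
    simp only [CompactlySupportedContinuousMap.coe_smul, Pi.smul_apply, smul_eq_mul]
    ring
  have hLpos : ∀ ρ ∈ Ioo (0 : ℝ) 1, ∀ φ, 0 ≤ φ → 0 ≤ L ρ φ := by
    intro ρ hρ φ hφ
    refine mul_nonneg (by positivity) (intervalIntegral.integral_nonneg (by positivity) ?_)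
    intro θ _
    have h1 := him _ (hball ρ hρ θ)
    have h2 : (circleMap 0 ρ θ).im = ρ * Real.sin θ := by
      simp [circleMap, Complex.exp_ofReal_mul_I_im]
    rw [h2] at h1
    have h3 : 0 ≤ (g (circleMap 0 ρ θ)).im * Real.sin θ := by
      by_contra hlt
      push Not at hlt
      nlinarith [hρ.1]
    have h4 : 0 ≤ φ (cs θ) := hφ (cs θ)
    calc (0 : ℝ) ≤ 2 * ((g (circleMap 0 ρ θ)).im * Real.sin θ) * φ (cs θ) := by positivity
      _ = _ := by ring
  let κ : Ioo (-1 : ℝ) 1 → C_c(Icc (-1 : ℝ) 1, ℝ) := fun s =>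
    ⟨⟨fun c => (s : ℝ) / (1 - 2 * (c : ℝ) * s + (s : ℝ) ^ 2),
      continuous_const.div (by fun_prop) fun c => (one_sub_two_mul_add_sq_pos c.2 s.2).ne'⟩,
      HasCompactSupport.of_compactSpace _⟩
  have hLκ : ∀ ρ ∈ Ioo (0 : ℝ) 1, ∀ s : Ioo (-1 : ℝ) 1,
      L ρ (κ s) = (g ((ρ * s : ℝ) : ℂ)).re - (g 0).re := fun ρ hρ s =>
    average_im_mul_kernel_eq hg hρ.1 hρ.2 s.2
  have hIoo : ∀ᶠ ρ in 𝓝[<] (1 : ℝ), ρ ∈ Ioo (0 : ℝ) 1 := Ioo_mem_nhdsLT (by norm_num)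
  have hLκt : ∀ s : Ioo (-1 : ℝ) 1,
      Tendsto (fun ρ => L ρ (κ s)) (𝓝[<] 1) (𝓝 ((g (s : ℝ)).re - (g 0).re)) := by
    intro s
    have hs : (((s : ℝ)) : ℂ) ∈ Metric.ball (0 : ℂ) 1 := by
      rw [mem_ball_zero_iff, Complex.norm_real, Real.norm_eq_abs]
      exact abs_lt.2 s.2
    have h1 : ContinuousAt g ((s : ℝ) : ℂ) :=
      (hg.differentiableAt (Metric.isOpen_ball.mem_nhds hs)).continuousAt
    have h2 : Tendsto (fun ρ : ℝ => ((ρ * s : ℝ) : ℂ)) (𝓝[<] 1) (𝓝 ((s : ℝ) : ℂ)) := by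
      have : Continuous fun ρ : ℝ => ((ρ * s : ℝ) : ℂ) := by fun_prop
      have h3 := this.tendsto 1
      rw [one_mul] at h3
      exact h3.mono_left nhdsWithin_le_nhds
    have h4 := ((Complex.continuous_re.tendsto _).comp (h1.tendsto.comp h2)).sub_const (g 0).re
    refine h4.congr' ?_
    filter_upwards [hIoo] with ρ hρ
    rw [hLκ ρ hρ s]
    rfl
  let 𝒰 : Ultrafilter ℝ := Ultrafilter.of (𝓝[<] 1)
  have h𝒰 : (𝒰 : Filter ℝ) ≤ 𝓝[<] 1 := Ultrafilter.of_le _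
  have hex : ∀ φ, ∃ a, Tendsto (fun ρ => L ρ φ) 𝒰 (𝓝 a) := by
    intro φ
    obtain ⟨M, hM⟩ : ∃ M, ∀ c, |φ c| ≤ M := by
      obtain ⟨M, hM⟩ := (isCompact_range φ.continuous).isBounded.exists_norm_le
      exact ⟨M, fun c => hM _ (mem_range_self c)⟩
    have hM0 : 0 ≤ M := (abs_nonneg _).trans (hM ⟨0, by norm_num⟩)
    let s : Ioo (-1 : ℝ) 1 := ⟨1 / 2, by norm_num⟩
    have hle : ∀ c, M ≤ 9 / 2 * M * κ s c := by
      intro c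
      have h1 : κ s c = (1 / 2) / (1 - 2 * (c : ℝ) * (1 / 2) + (1 / 2) ^ 2) := rfl
      have h2 := one_sub_two_mul_add_sq_pos c.2 s.2
      have h3 : 2 / 9 ≤ κ s c := by
        rw [h1, le_div_iff₀ h2]
        linarith [c.2.1]
      nlinarith
    have hb : ∀ᶠ ρ in 𝓝[<] (1 : ℝ), L ρ φ ∈ Icc
        (-(9 / 2 * M * ((g (s : ℝ)).re - (g 0).re + 1)))
        (9 / 2 * M * ((g (s : ℝ)).re - (g 0).re + 1)) := by
      filter_upwards [hIoo, (hLκt s).eventually_le_const (lt_add_one _)] with ρ hρ hρ2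
      have h1 := hLpos ρ hρ ((9 / 2 * M) • κ s + φ) (fun c => by
        have := hle c; have := (abs_le.1 (hM c)).1
        simp only [CompactlySupportedContinuousMap.coe_add, Pi.add_apply,
          CompactlySupportedContinuousMap.coe_smul, Pi.smul_apply, smul_eq_mul,
          CompactlySupportedContinuousMap.coe_zero, Pi.zero_apply]
        linarith)
      have h2 := hLpos ρ hρ ((9 / 2 * M) • κ s + (-1 : ℝ) • φ) (fun c => by
        have := hle c; have := (abs_le.1 (hM c)).2
        simp only [CompactlySupportedContinuousMap.coe_add, Pi.add_apply,
          CompactlySupportedContinuousMap.coe_smul, Pi.smul_apply, smul_eq_mul,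
          CompactlySupportedContinuousMap.coe_zero, Pi.zero_apply]
        linarith)
      rw [hLadd ρ hρ, hLsmul] at h1
      rw [hLadd ρ hρ, hLsmul, hLsmul] at h2
      have h3 := mul_le_mul_of_nonneg_left hρ2 (by positivity : (0 : ℝ) ≤ 9 / 2 * M)
      constructor <;> linarith
    obtain ⟨a, -, ha⟩ := isCompact_Icc.ultrafilter_le_nhds (𝒰.map fun ρ => L ρ φ)
      (le_principal_iff.2 (h𝒰 hb))
    exact ⟨a, ha⟩
  choose Λ hΛ using hex
  let Λ' : C_c(Icc (-1 : ℝ) 1, ℝ) →ₗ[ℝ] ℝ :=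
    { toFun := Λ
      map_add' := fun φ ψ => tendsto_nhds_unique (hΛ (φ + ψ))
        (((hΛ φ).add (hΛ ψ)).congr' (by
          filter_upwards [h𝒰 hIoo] with ρ hρ
          exact (hLadd ρ hρ φ ψ).symm))
      map_smul' := fun a φ => tendsto_nhds_unique (hΛ (a • φ))
        (((hΛ φ).const_mul a).congr fun ρ => (hLsmul ρ a φ).symm) }
  let P : C_c(Icc (-1 : ℝ) 1, ℝ) →ₚ[ℝ] ℝ := PositiveLinearMap.mk₀ Λ' fun φ hφ =>
    ge_of_tendsto (hΛ φ) (by filter_upwards [h𝒰 hIoo] with ρ hρ using hLpos ρ hρ φ hφ)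
  refine ⟨RealRMK.rieszMeasure P, ?_, fun s hs => ?_⟩
  · infer_instance
  · have h1 := RealRMK.integral_rieszMeasure P (κ ⟨s, hs⟩)
    have h2 : P (κ ⟨s, hs⟩) = (g s).re - (g 0).re :=
      tendsto_nhds_unique (hΛ _) ((hLκt ⟨s, hs⟩).mono_left h𝒰)
    rw [h2] at h1
    change _ = _ + ∫ c, κ ⟨s, hs⟩ c ∂_
    rw [h1]; ring

theorem eval_reflect_eq_sum_range {f : ℝ[X]} {n : ℕ} (hf : f.natDegree ≤ n) (c : ℝ) :
    (f.reflect n).eval c = ∑ i ∈ Finset.range (n + 1), f.coeff i * c ^ (n - i) := by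
  have h : (f.reflect n).natDegree < n + 1 := by
    refine Nat.lt_succ_of_le ((natDegree_reflect_le).trans (max_le le_rfl hf))
  rw [eval_eq_sum_range' h, ← Finset.sum_range_reflect]
  refine Finset.sum_congr rfl fun i hi => ?_
  have hi' : i ≤ n := Nat.lt_succ_iff.1 (Finset.mem_range.1 hi)
  rw [coeff_reflect, revAt_le (by omega)]
  congr 2
  omega

theorem natDegree_prod_X_sub_C_pow (T : Finset ℝ) (e : ℝ → ℕ) :
    (∏ x ∈ T, (X - C x) ^ e x).natDegree = ∑ x ∈ T, e x := by
  rw [natDegree_prod_of_monic _ _ fun x _ => (monic_X_sub_C x).pow _]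
  simp

theorem eval_reflect_prod_X_sub_C_pow (T : Finset ℝ) (e : ℝ → ℕ) (c : ℝ) :
    ((∏ x ∈ T, (X - C x) ^ e x).reflect (∑ x ∈ T, e x)).eval c = ∏ x ∈ T, (1 - c * x) ^ e x := by
  have hpow : ∀ (x : ℝ) (n : ℕ), (((X - C x) ^ n).reflect n).eval c = (1 - c * x) ^ n := by
    intro x n
    induction n with
    | zero => simp
    | succ n ih =>
      rw [pow_succ, reflect_mul _ _ (by simp) (by simp : (X - C x).natDegree ≤ 1), eval_mul, ih,
        eval_reflect_eq_sum_range (by simp)]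
      simp [Finset.sum_range_succ]
      ring
  induction T using Finset.induction_on with
  | empty => simp
  | insert a T ha ih =>
    rw [Finset.prod_insert ha, Finset.prod_insert ha, Finset.sum_insert ha,
      reflect_mul _ _ (by simp) ?_, eval_mul, hpow, ih]
    rw [natDegree_prod_X_sub_C_pow]

theorem one_sub_mul_sum_eq (L : ℕ → ℝ) (c k : ℝ) (n : ℕ) :
    (1 - c * k) * ∑ j ∈ Finset.range (n + 1),
        (∑ i ∈ Finset.range (j + 1), L i * c ^ (j - i)) * k ^ j =
      ∑ i ∈ Finset.range (n + 1), L i * k ^ i -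
        c * (∑ i ∈ Finset.range (n + 1), L i * c ^ (n - i)) * k ^ (n + 1) := by
  have hB : ∀ n, ∑ i ∈ Finset.range (n + 1 + 1), L i * c ^ (n + 1 - i) =
      c * ∑ i ∈ Finset.range (n + 1), L i * c ^ (n - i) + L (n + 1) := by
    intro n
    rw [Finset.sum_range_succ, Finset.mul_sum]
    congr 1
    · refine Finset.sum_congr rfl fun i hi => ?_
      rw [Nat.succ_sub (Nat.lt_succ_iff.1 (Finset.mem_range.1 hi)), pow_succ]
      ring
    · simp
  induction n with
  | zero => simp; ring
  | succ n ih =>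
    rw [Finset.sum_range_succ, mul_add, ih, hB,
      Finset.sum_range_succ (fun i => L i * k ^ i) (n + 1)]
    ring

theorem X_sub_C_pow_dvd_of_isBigO {f : ℝ[X]} {x : ℝ} {e : ℕ}
    (h : (fun k => f.eval k) =O[𝓝 x] fun k => (k - x) ^ e) : (X - C x) ^ e ∣ f := by
  induction e with
  | zero => simp
  | succ e ih =>
    have ht : Tendsto (fun k : ℝ => k - x) (𝓝 x) (𝓝 0) := by
      have : Continuous fun k : ℝ => k - x := by fun_prop
      simpa using this.tendsto x
    have h0 := (Asymptotics.isBigO_refl (fun k : ℝ => (k - x) ^ e) (𝓝 x)).mul (ht.isBigO_one ℝ)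
    simp only [← pow_succ, mul_one] at h0
    obtain ⟨g, rfl⟩ := ih (h.trans h0)
    have h1 : (fun k => g.eval k) =O[𝓝[≠] x] fun k => k - x := by
      obtain ⟨A, hA⟩ := h.bound
      refine Asymptotics.IsBigO.of_bound A ?_
      filter_upwards [nhdsWithin_le_nhds hA, self_mem_nhdsWithin] with k hk hkx
      have h2 : 0 < ‖(k - x) ^ e‖ := norm_pos_iff.2 (pow_ne_zero _ (sub_ne_zero.2 hkx))
      simp only [eval_mul, eval_pow, eval_sub, eval_X, eval_C, norm_mul, pow_succ] at hk
      rw [mul_left_comm] at hk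
      exact le_of_mul_le_mul_left hk h2
    have h2 : Tendsto (fun k => g.eval k) (𝓝[≠] x) (𝓝 0) :=
      h1.trans_tendsto (ht.mono_left nhdsWithin_le_nhds)
    have h3 : g.eval x = 0 :=
      tendsto_nhds_unique (g.continuous.continuousAt.tendsto.mono_left nhdsWithin_le_nhds) h2
    rw [pow_succ]
    exact mul_dvd_mul_left _ (dvd_iff_isRoot.2 h3)

theorem prod_X_sub_C_pow_dvd_of_isBigO {f : ℝ[X]} {T : Finset ℝ} {e : ℝ → ℕ}
    (h : ∀ x ∈ T, (fun k => f.eval k) =O[𝓝 x] fun k => (k - x) ^ e x) :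
    ∏ x ∈ T, (X - C x) ^ e x ∣ f := by
  refine Finset.prod_dvd_of_coprime ?_ fun x hx => X_sub_C_pow_dvd_of_isBigO (h x hx)
  intro x _ y _ hxy
  exact (pairwise_coprime_X_sub_C (fun _ _ h => h) hxy).pow

theorem eq_zero_of_isBigO_of_degree_lt {f : ℝ[X]} {T : Finset ℝ} {e : ℝ → ℕ}
    (hf : f.degree < (∑ x ∈ T, e x : ℕ))
    (h : ∀ x ∈ T, (fun k => f.eval k) =O[𝓝 x] fun k => (k - x) ^ e x) : f = 0 := by
  refine eq_zero_of_dvd_of_degree_lt (prod_X_sub_C_pow_dvd_of_isBigO h) ?_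
  rwa [degree_eq_natDegree (monic_prod_of_monic _ _ fun x _ => (monic_X_sub_C x).pow _).ne_zero,
    natDegree_prod_X_sub_C_pow]

theorem integrable_of_continuousOn_Icc {ν : Measure ℝ} [IsFiniteMeasure ν] {a b : ℝ}
    (hν : ∀ᵐ c ∂ν, c ∈ Icc a b) {f : ℝ → ℝ} (hf : ContinuousOn f (Icc a b)) :
    Integrable f ν := by
  have h := hf.integrableOn_Icc (μ := ν)
  rwa [IntegrableOn, Measure.restrict_eq_self_of_ae_mem hν] at h

theorem one_sub_mul_pos {c k : ℝ} (hc : c ∈ Icc (-1 : ℝ) 1) (hk : k ∈ Ioo (-1 : ℝ) 1) :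
    0 < 1 - c * k := by
  have h1 : |c * k| ≤ |k| := by
    rw [abs_mul]
    exact mul_le_of_le_one_left (abs_nonneg _) (abs_le.2 hc)
  linarith [le_abs_self (c * k), abs_lt.2 hk]

/-- Gaussian-quadrature argument: a function of the form `P + Q * S`, with `S` a Stieltjes-type
transform of `ν`, can only have many zeros if `ν` is carried by the zeros of `c * Q*(c)`, where
`Q*` is the reflection of `Q`. -/
theorem ae_mul_eval_reflect_eq_zero {ν : Measure ℝ} [IsFiniteMeasure ν]
    (hν : ∀ᵐ c ∂ν, c ∈ Icc (-1 : ℝ) 1) {S : ℝ → ℝ} {s₀ : ℝ}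
    (hS : ∀ k ∈ Ioo (-1 : ℝ) 1, S k = s₀ + ∫ c, k ^ 2 / (1 - c * k) ∂ν)
    {P Q : ℝ[X]} {M n : ℕ} (hP : P.natDegree ≤ M) (hQ : Q.natDegree ≤ n) (hnM : n ≤ M)
    {T : Finset ℝ} (hT : ∀ x ∈ T, x ∈ Ioo (-1 : ℝ) 1) {e : ℝ → ℕ}
    (hN : M + n + 3 ≤ ∑ x ∈ T, e x)
    (hO : ∀ x ∈ T, (fun k => P.eval k + Q.eval k * S k) =O[𝓝 x] fun k => (k - x) ^ e x) :
    ∀ᵐ c ∂ν, c * (Q.reflect n).eval c = 0 := by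
  obtain ⟨δ, t, D, hD, hND, hMD⟩ : ∃ δ t D, D = (2 * t + δ + 2) + (n + n) ∧
      ∑ x ∈ T, e x = D + 1 ∧ M + n + δ + 1 ≤ D := by
    generalize ∑ x ∈ T, e x = N at hN
    exact ⟨(N + 1) % 2, (N - 3 - (N + 1) % 2 - n - n) / 2, N - 1, by omega, by omega, by omega⟩
  set W : ℝ[X] := ∏ x ∈ T, (X - C x) ^ e x with hW
  have hWm : W.Monic := monic_prod_of_monic _ _ fun x _ => (monic_X_sub_C x).pow _
  have hWd : W.natDegree = D + 1 := by rw [hW, natDegree_prod_X_sub_C_pow, hND]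
  have hWc : W.coeff (D + 1) = 1 := by rw [← hWd]; exact hWm
  set V : ℝ[X] := X ^ (δ + 2) * (Q * Q) with hV
  have hVd : V.natDegree ≤ D := by
    have h1 := natDegree_mul_le (p := (X : ℝ[X]) ^ (δ + 2)) (q := Q * Q)
    have h2 := natDegree_mul_le (p := Q) (q := Q)
    rw [natDegree_X_pow, ← hV] at h1
    omega
  set Wt : ℝ → ℝ := fun c => (W.reflect (D + 1)).eval c with hWt
  set R : ℝ → ℝ := fun c => (V.reflect D).eval c with hR
  have hWtpos : ∀ c ∈ Icc (-1 : ℝ) 1, 0 < Wt c := by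
    intro c hc
    simp only [hWt, hW]
    rw [← hND, eval_reflect_prod_X_sub_C_pow]
    refine Finset.prod_pos fun x hx => pow_pos ?_ _
    exact one_sub_mul_pos hc (hT x hx)
  have hReq : ∀ c, R c = (c ^ t * (Q.reflect n).eval c) ^ 2 := by
    intro c
    simp only [hR, hV, hD]
    rw [reflect_mul _ _ (by rw [natDegree_X_pow]; omega)
      (natDegree_mul_le.trans (add_le_add hQ hQ)), reflect_mul _ _ hQ hQ, reflect_monomial,
      revAt_le (by omega), show 2 * t + δ + 2 - (δ + 2) = t * 2 by omega]
    simp only [eval_mul, eval_pow, eval_X]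
    ring
  have hWtc : Continuous Wt := (W.reflect (D + 1)).continuous
  have hRc : Continuous R := (V.reflect D).continuous
  set L : ℝ → ℕ → ℝ := fun c i => V.coeff i * Wt c - c * R c * W.coeff i with hL
  set B : ℝ → ℕ → ℝ := fun c j => ∑ i ∈ Finset.range (j + 1), L c i * c ^ (j - i) with hB
  have hBD : ∀ c, B c D = R c := by
    intro c
    have h1 : Wt c = ∑ i ∈ Finset.range (D + 1), W.coeff i * c ^ (D + 1 - i) + 1 := by
      simp only [hWt]
      rw [eval_reflect_eq_sum_range hWd.le, Finset.sum_range_succ, hWc]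
      simp
    have h2 : ∑ i ∈ Finset.range (D + 1), W.coeff i * c ^ (D + 1 - i) =
        c * ∑ i ∈ Finset.range (D + 1), W.coeff i * c ^ (D - i) := by
      rw [Finset.mul_sum]
      refine Finset.sum_congr rfl fun i hi => ?_
      rw [Nat.succ_sub (Nat.lt_succ_iff.1 (Finset.mem_range.1 hi)), pow_succ]
      ring
    have h3 : R c = ∑ i ∈ Finset.range (D + 1), V.coeff i * c ^ (D - i) :=
      eval_reflect_eq_sum_range hVd c
    have h4 : B c D = Wt c * ∑ i ∈ Finset.range (D + 1), V.coeff i * c ^ (D - i) -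
        c * R c * ∑ i ∈ Finset.range (D + 1), W.coeff i * c ^ (D - i) := by
      simp only [hB, hL]
      rw [Finset.mul_sum, Finset.mul_sum, ← Finset.sum_sub_distrib]
      exact Finset.sum_congr rfl fun i _ => by ring
    rw [h4, ← h3]
    rw [h2] at h1
    linear_combination R c * h1
  have hid : ∀ c k, V.eval k * Wt c - c * R c * W.eval k =
      (1 - c * k) * ∑ j ∈ Finset.range (D + 1), B c j * k ^ j := by
    intro c k
    have h1 := one_sub_mul_sum_eq (L c) c k D
    have h2 : W.eval k = ∑ i ∈ Finset.range (D + 1), W.coeff i * k ^ i + k ^ (D + 1) := by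
      rw [eval_eq_sum_range, hWd, Finset.sum_range_succ, hWc, one_mul]
    have h3 : V.eval k = ∑ i ∈ Finset.range (D + 1), V.coeff i * k ^ i :=
      eval_eq_sum_range' (Nat.lt_succ_of_le hVd) k
    have h4 : ∑ i ∈ Finset.range (D + 1), L c i * k ^ i =
        Wt c * V.eval k - c * R c * ∑ i ∈ Finset.range (D + 1), W.coeff i * k ^ i := by
      rw [h3, Finset.mul_sum, Finset.mul_sum, ← Finset.sum_sub_distrib]
      exact Finset.sum_congr rfl fun i _ => by simp only [hL]; ring
    have h5 : ∑ i ∈ Finset.range (D + 1), L c i * c ^ (D - i) = R c := hBD c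
    simp only [hB]
    rw [h1, h4, h5, h2]
    ring
  have hBc : ∀ j, Continuous fun c => B c j := by
    intro j
    simp only [hB, hL]
    fun_prop
  have hBi : ∀ j, Integrable (fun c => B c j / Wt c) ν := fun j =>
    integrable_of_continuousOn_Icc hν
      ((hBc j).continuousOn.div hWtc.continuousOn fun c hc => (hWtpos c hc).ne')
  have hGi : ∀ k ∈ Ioo (-1 : ℝ) 1, Integrable (fun c => c * R c / Wt c / (1 - c * k)) ν := by
    intro k hk
    refine integrable_of_continuousOn_Icc hν (((continuous_id.mul hRc).continuousOn.div
      hWtc.continuousOn fun c hc => (hWtpos c hc).ne').div (by fun_prop) fun c hc =>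
      (one_sub_mul_pos hc hk).ne')
  set G : ℝ → ℝ := fun k => ∫ c, c * R c / Wt c / (1 - c * k) ∂ν with hG
  set r : ℝ[X] := X ^ δ with hr
  set Y : ℝ[X] := r * Q * (P + C s₀ * Q) with hY
  have hYd : Y.natDegree ≤ M + n + δ := by
    have h1 := natDegree_mul_le (p := r * Q) (q := P + C s₀ * Q)
    have h2 := natDegree_mul_le (p := r) (q := Q)
    have h4 : r.natDegree = δ := natDegree_X_pow δ
    have h3 : (P + C s₀ * Q).natDegree ≤ M :=
      natDegree_add_le_of_degree_le hP ((natDegree_C_mul_le _ _).trans (hQ.trans hnM))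
    rw [← hY] at h1
    omega
  set Z : ℝ[X] := Y + ∑ j ∈ Finset.range (D + 1), C (∫ c, B c j / Wt c ∂ν) * X ^ j with hZ
  have hZd : Z.degree < (D + 1 : ℕ) := by
    refine (degree_add_le _ _).trans_lt (max_lt ?_ ?_)
    · exact (degree_le_natDegree).trans_lt (by exact_mod_cast (by omega : Y.natDegree < D + 1))
    · refine (degree_sum_le _ _).trans_lt ((Finset.sup_lt_iff (WithBot.bot_lt_coe _)).2 ?_)
      intro j hj
      exact (degree_C_mul_X_pow_le _ _).trans_lt (by exact_mod_cast Finset.mem_range.1 hj)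
  have hZev : ∀ k ∈ Ioo (-1 : ℝ) 1, Z.eval k =
      (r * Q).eval k * (P.eval k + Q.eval k * S k) - W.eval k * G k := by
    intro k hk
    have h1 : ∫ c, V.eval k / (1 - c * k) ∂ν =
        ∑ j ∈ Finset.range (D + 1), (∫ c, B c j / Wt c ∂ν) * k ^ j + W.eval k * G k := by
      simp only [hG]
      simp_rw [← integral_mul_const, ← integral_const_mul]
      rw [← integral_finsetSum _ fun j _ => (hBi j).mul_const _,
        ← integral_add (integrable_finsetSum _ fun j _ => (hBi j).mul_const _)
          ((hGi k hk).const_mul _)]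
      refine integral_congr_ae ?_
      filter_upwards [hν] with c hc
      have hd := (one_sub_mul_pos hc hk).ne'
      have hw := (hWtpos c hc).ne'
      have h2 : ∑ j ∈ Finset.range (D + 1), B c j / Wt c * k ^ j =
          (∑ j ∈ Finset.range (D + 1), B c j * k ^ j) / Wt c := by
        rw [Finset.sum_div]
        exact Finset.sum_congr rfl fun j _ => by ring
      rw [h2]
      have h3 := hid c k
      field_simp
      linear_combination h3
    have h2 : ∫ c, V.eval k / (1 - c * k) ∂ν =
        (r * Q).eval k * Q.eval k * ∫ c, k ^ 2 / (1 - c * k) ∂ν := by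
      rw [← integral_const_mul]
      refine integral_congr_ae (Eventually.of_forall fun c => ?_)
      simp only [hV, hr, eval_mul, eval_pow, eval_X]
      ring
    have h3 : Z.eval k = Y.eval k +
        ∑ j ∈ Finset.range (D + 1), (∫ c, B c j / Wt c ∂ν) * k ^ j := by
      simp [hZ, eval_finsetSum]
    have h4 : Y.eval k = (r * Q).eval k * (P.eval k + s₀ * Q.eval k) := by
      simp [hY]
    rw [h3, h4, hS k hk]
    linear_combination h2 - h1
  obtain ⟨A, hA⟩ : ∃ A, ∀ c ∈ Icc (-1 : ℝ) 1, ‖c * R c / Wt c‖ ≤ A :=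
    isCompact_Icc.exists_bound_of_continuousOn ((continuous_id.mul hRc).continuousOn.div
      hWtc.continuousOn fun c hc => (hWtpos c hc).ne')
  have hGb : ∀ x ∈ T, G =O[𝓝 x] fun _ => (1 : ℝ) := by
    intro x hx
    obtain ⟨hx1, hx2⟩ := hT x hx
    have hx3 : |x| < 1 := abs_lt.2 ⟨hx1, hx2⟩
    refine Asymptotics.IsBigO.of_bound (A / ((1 - |x|) / 2) * ν.real univ) ?_
    have hnear : ∀ᶠ k in 𝓝 x, |k| < (1 + |x|) / 2 :=
      continuous_abs.continuousAt.eventually_lt_const (by linarith)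
    filter_upwards [hnear] with k hk
    rw [norm_one, mul_one]
    refine norm_integral_le_of_norm_le_const ?_
    filter_upwards [hν] with c hc
    have hck : |c * k| ≤ |k| := by
      rw [abs_mul]
      exact mul_le_of_le_one_left (abs_nonneg _) (abs_le.2 hc)
    have hlow : (1 - |x|) / 2 ≤ ‖1 - c * k‖ := by
      rw [Real.norm_eq_abs]
      refine le_trans ?_ (le_abs_self _)
      linarith [le_abs_self (c * k)]
    rw [norm_div]
    exact div_le_div₀ ((norm_nonneg _).trans (hA c hc)) (hA c hc) (by linarith) hlow
  have hZO : ∀ x ∈ T, (fun k => Z.eval k) =O[𝓝 x] fun k => (k - x) ^ e x := by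
    intro x hx
    have h1 : (fun k => (r * Q).eval k) =O[𝓝 x] fun _ => (1 : ℝ) :=
      (r * Q).continuous.continuousAt.tendsto.isBigO_one ℝ
    obtain ⟨H, hH⟩ : (X - C x) ^ e x ∣ W := Finset.dvd_prod_of_mem _ hx
    have h2 : (fun k => W.eval k) =O[𝓝 x] fun k => (k - x) ^ e x := by
      have h3 := (Asymptotics.isBigO_refl (fun k : ℝ => (k - x) ^ e x) (𝓝 x)).mul
        (H.continuous.continuousAt.tendsto.isBigO_one ℝ)
      simpa [hH] using h3
    have h3 := (h1.mul (hO x hx)).sub (by simpa using h2.mul (hGb x hx))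
    simp only [one_mul] at h3
    refine h3.congr' ?_ EventuallyEq.rfl
    filter_upwards [Ioo_mem_nhds (hT x hx).1 (hT x hx).2] with k hk
    exact (hZev k hk).symm
  have hZ0 : Z = 0 := eq_zero_of_isBigO_of_degree_lt (by rwa [hND]) hZO
  have hRint : ∫ c, R c / Wt c ∂ν = 0 := by
    have h1 : Z.coeff D = Y.coeff D + ∫ c, B c D / Wt c ∂ν := by
      simp [hZ, coeff_X_pow]
    rw [hZ0, coeff_zero, coeff_eq_zero_of_natDegree_lt (by omega), zero_add] at h1
    simp_rw [hBD] at h1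
    exact h1.symm
  have hRi : Integrable (fun c => R c / Wt c) ν := by
    have := hBi D
    simp_rw [hBD] at this
    exact this
  have hnn : 0 ≤ᵐ[ν] fun c => R c / Wt c := by
    filter_upwards [hν] with c hc
    exact div_nonneg (by rw [hReq]; positivity) (hWtpos c hc).le
  filter_upwards [(integral_eq_zero_iff_of_nonneg_ae hnn hRi).1 hRint, hν] with c h0 hc
  have h1 : R c = 0 := (div_eq_zero_iff.1 h0).resolve_right (hWtpos c hc).ne'
  rw [hReq] at h1
  rcases mul_eq_zero.1 (pow_eq_zero_iff (two_ne_zero)|>.1 h1) with h2 | h2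
  · rw [eq_zero_of_pow_eq_zero h2, zero_mul]
  · rw [h2, mul_zero]

theorem intervalIntegrable_inv_sqrt_one_sub_sq :
    IntervalIntegrable (fun z : ℝ => (Real.sqrt (1 - z ^ 2))⁻¹) volume 0 1 := by
  have h := Polynomial.Chebyshev.intervalIntegrable_sqrt_one_sub_sq_inv
  simp only [Real.sqrt_inv] at h
  exact h.mono_set (by simp [uIcc_of_le, Icc_subset_Icc])

/-- The integrals `∫₀¹ (1 - x z²)ᵃ / √(1 - z²) dz`; the complete elliptic integrals correspond to
`a = ± 1 / 2` and `x = k²`. -/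
noncomputable def ellipticIntegral (a x : ℂ) : ℂ :=
  ∫ z in (0 : ℝ)..1, ((Real.sqrt (1 - z ^ 2))⁻¹ : ℝ) * (1 - x * (z : ℂ) ^ 2) ^ a

theorem one_sub_mul_sq_mem_slitPlane {x : ℂ} (hx : 1 - x ∈ Complex.slitPlane) {z : ℝ}
    (hz : z ∈ Icc (0 : ℝ) 1) : 1 - x * (z : ℂ) ^ 2 ∈ Complex.slitPlane := by
  have h := Complex.starConvex_one_slitPlane hx (a := 1 - z ^ 2) (b := z ^ 2)
    (by nlinarith [hz.1, hz.2]) (by positivity) (by ring)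
  convert h using 1
  simp only [Complex.real_smul]
  push_cast
  ring

theorem continuousOn_one_sub_mul_sq_cpow (a : ℂ) {x : ℂ} (hx : 1 - x ∈ Complex.slitPlane) :
    ContinuousOn (fun z : ℝ => (1 - x * (z : ℂ) ^ 2) ^ a) (Icc 0 1) :=
  ContinuousOn.cpow_const (by fun_prop) fun _ hz => one_sub_mul_sq_mem_slitPlane hx hz

theorem intervalIntegrable_inv_sqrt_mul {f : ℝ → ℂ} (hf : ContinuousOn f (Icc 0 1)) :
    IntervalIntegrable (fun z : ℝ => (((Real.sqrt (1 - z ^ 2))⁻¹ : ℝ) : ℂ) * f z) volume 0 1 := by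
  have h : IntervalIntegrable (fun z : ℝ => (((Real.sqrt (1 - z ^ 2))⁻¹ : ℝ) : ℂ)) volume 0 1 :=
    ⟨intervalIntegrable_inv_sqrt_one_sub_sq.1.ofReal,
      intervalIntegrable_inv_sqrt_one_sub_sq.2.ofReal⟩
  exact h.mul_continuousOn (by rwa [uIcc_of_le zero_le_one])

theorem isOpen_one_sub_mem_slitPlane : IsOpen {x : ℂ | 1 - x ∈ Complex.slitPlane} :=
  Complex.isOpen_slitPlane.preimage (continuous_const.sub continuous_id)

theorem differentiableAt_ellipticIntegral (a : ℂ) {x : ℂ} (hx : 1 - x ∈ Complex.slitPlane) :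
    DifferentiableAt ℂ (ellipticIntegral a) x := by
  obtain ⟨ε, hε, hball⟩ := Metric.nhds_basis_closedBall.mem_iff.1
    (isOpen_one_sub_mem_slitPlane.mem_nhds hx)
  set F' : ℂ → ℝ → ℂ := fun y z => a * (1 - y * (z : ℂ) ^ 2) ^ (a - 1) * (-(z : ℂ) ^ 2) with hF'
  have hcont : ContinuousOn (fun p : ℂ × ℝ => F' p.1 p.2) (Metric.closedBall x ε ×ˢ Icc 0 1) := by
    refine (continuousOn_const.mul (ContinuousOn.cpow_const (by fun_prop) fun p hp => ?_)).mul
      (by fun_prop)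
    exact one_sub_mul_sq_mem_slitPlane (hball hp.1) hp.2
  obtain ⟨A, hA⟩ := ((isCompact_closedBall x ε).prod isCompact_Icc).exists_bound_of_continuousOn
    hcont
  have hsub : uIoc (0 : ℝ) 1 ⊆ Icc 0 1 := by
    rw [uIoc_of_le zero_le_one]
    exact Ioc_subset_Icc_self
  have hmeas : ∀ f : ℝ → ℂ, ContinuousOn f (Icc 0 1) → AEStronglyMeasurable
      (fun z : ℝ => (((Real.sqrt (1 - z ^ 2))⁻¹ : ℝ) : ℂ) * f z) (volume.restrict (uIoc 0 1)) :=
    fun f hf => (intervalIntegrable_iff.1 (intervalIntegrable_inv_sqrt_mul hf)).aestronglyMeasurable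
  refine (intervalIntegral.hasDerivAt_integral_of_dominated_loc_of_deriv_le
    (F := fun y z => (((Real.sqrt (1 - z ^ 2))⁻¹ : ℝ) : ℂ) * (1 - y * (z : ℂ) ^ 2) ^ a)
    (F' := fun y z => (((Real.sqrt (1 - z ^ 2))⁻¹ : ℝ) : ℂ) * F' y z)
    (bound := fun z => (Real.sqrt (1 - z ^ 2))⁻¹ * A)
    (Metric.closedBall_mem_nhds x hε) ?_ ?_ ?_ ?_ ?_ ?_).2.differentiableAt
  · filter_upwards [Metric.closedBall_mem_nhds x hε] with y hy
    exact hmeas _ (continuousOn_one_sub_mul_sq_cpow a (hball hy))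
  · exact intervalIntegrable_inv_sqrt_mul (continuousOn_one_sub_mul_sq_cpow a hx)
  · refine hmeas _ (hcont.comp (f := fun z : ℝ => (x, z)) (by fun_prop) fun z hz => ?_)
    exact ⟨Metric.mem_closedBall_self hε.le, hz⟩
  · refine Eventually.of_forall fun z hz y hy => ?_
    rw [norm_mul, Complex.norm_real, Real.norm_of_nonneg (by positivity)]
    exact mul_le_mul_of_nonneg_left (hA (y, z) ⟨hy, hsub hz⟩) (by positivity)
  · exact intervalIntegrable_inv_sqrt_one_sub_sq.mul_const A
  · refine Eventually.of_forall fun z hz y hy => ?_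
    refine HasDerivAt.const_mul _ (HasDerivAt.cpow_const ?_
      (one_sub_mul_sq_mem_slitPlane (hball hy) (hsub hz)))
    simpa using (HasDerivAt.mul_const (hasDerivAt_id y) ((z : ℂ) ^ 2)).const_sub 1

theorem re_ellipticIntegral (a : ℂ) {x : ℂ} (hx : 1 - x ∈ Complex.slitPlane) :
    (ellipticIntegral a x).re = ∫ z in (0 : ℝ)..1, (Real.sqrt (1 - z ^ 2))⁻¹ *
      ((1 - x * (z : ℂ) ^ 2) ^ a).re := by
  rw [ellipticIntegral, ← Complex.reCLM_apply, ← Complex.reCLM.intervalIntegral_comp_comm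
    (intervalIntegrable_inv_sqrt_mul (continuousOn_one_sub_mul_sq_cpow a hx))]
  simp only [Complex.reCLM_apply, Complex.re_ofReal_mul]

theorem im_ellipticIntegral (a : ℂ) {x : ℂ} (hx : 1 - x ∈ Complex.slitPlane) :
    (ellipticIntegral a x).im = ∫ z in (0 : ℝ)..1, (Real.sqrt (1 - z ^ 2))⁻¹ *
      ((1 - x * (z : ℂ) ^ 2) ^ a).im := by
  rw [ellipticIntegral, ← Complex.imCLM_apply, ← Complex.imCLM.intervalIntegral_comp_comm
    (intervalIntegrable_inv_sqrt_mul (continuousOn_one_sub_mul_sq_cpow a hx))]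
  simp only [Complex.imCLM_apply, Complex.im_ofReal_mul]

theorem re_cpow_half_pos {u : ℂ} (hu : u ∈ Complex.slitPlane) : 0 < (u ^ (1 / 2 : ℂ)).re := by
  rw [Complex.cpow_def_of_ne_zero (Complex.slitPlane_ne_zero hu), Complex.exp_re]
  refine mul_pos (Real.exp_pos _) (Real.cos_pos_of_mem_Ioo ?_)
  have h1 : (Complex.log u * (1 / 2)).im = u.arg / 2 := by
    rw [show (1 / 2 : ℂ) = ((1 / 2 : ℝ) : ℂ) by push_cast; ring, Complex.im_mul_ofReal,
      Complex.log_im]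
    ring
  rw [h1]
  have h2 := Complex.neg_pi_lt_arg u
  have h3 := lt_of_le_of_ne (Complex.arg_le_pi u) (Complex.mem_slitPlane_iff_arg.1 hu).1
  constructor <;> linarith

theorem im_eq_two_mul_re_mul_im_cpow_half (u : ℂ) :
    u.im = 2 * (u ^ (1 / 2 : ℂ)).re * (u ^ (1 / 2 : ℂ)).im := by
  have h : (u ^ (1 / 2 : ℂ)) ^ 2 = u := by
    rw [one_div]
    exact_mod_cast Complex.cpow_nat_inv_pow u two_ne_zero
  conv_lhs => rw [← h]
  rw [pow_two, Complex.mul_im]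
  ring

theorem re_cpow_neg_half_pos {u : ℂ} (hu : u ∈ Complex.slitPlane) :
    0 < (u ^ (-1 / 2 : ℂ)).re := by
  rw [show (-1 / 2 : ℂ) = -(1 / 2) by ring, Complex.cpow_neg, Complex.inv_re]
  have h := re_cpow_half_pos hu
  refine div_pos h (Complex.normSq_pos.2 fun h0 => ?_)
  rw [h0, Complex.zero_re] at h
  exact lt_irrefl _ h

theorem im_cpow_half_mul_im_nonneg {u : ℂ} (hu : u ∈ Complex.slitPlane) :
    0 ≤ (u ^ (1 / 2 : ℂ)).im * u.im := by
  rw [im_eq_two_mul_re_mul_im_cpow_half u]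
  have h := re_cpow_half_pos hu
  calc (0 : ℝ) ≤ 2 * (u ^ (1 / 2 : ℂ)).re * (u ^ (1 / 2 : ℂ)).im ^ 2 := by positivity
    _ = _ := by ring

theorem im_cpow_neg_half_mul_im_nonpos {u : ℂ} (hu : u ∈ Complex.slitPlane) :
    (u ^ (-1 / 2 : ℂ)).im * u.im ≤ 0 := by
  rw [show (-1 / 2 : ℂ) = -(1 / 2) by ring, Complex.cpow_neg, Complex.inv_im, div_mul_eq_mul_div]
  refine div_nonpos_of_nonpos_of_nonneg ?_ (Complex.normSq_nonneg _)
  linarith [im_cpow_half_mul_im_nonneg hu]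

theorem re_ellipticIntegral_pos {a x : ℂ} (hx : 1 - x ∈ Complex.slitPlane)
    (ha : ∀ u ∈ Complex.slitPlane, 0 < (u ^ a).re) : 0 < (ellipticIntegral a x).re := by
  rw [re_ellipticIntegral a hx]
  refine intervalIntegral.intervalIntegral_pos_of_pos_on ?_ (fun z hz => ?_) zero_lt_one
  · refine intervalIntegrable_inv_sqrt_one_sub_sq.mul_continuousOn ?_
    rw [uIcc_of_le zero_le_one]
    exact Complex.continuous_re.comp_continuousOn (continuousOn_one_sub_mul_sq_cpow a hx)
  · have h1 : 0 < 1 - z ^ 2 := by nlinarith [hz.1, hz.2]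
    exact mul_pos (inv_pos.2 (Real.sqrt_pos.2 h1))
      (ha _ (one_sub_mul_sq_mem_slitPlane hx (Ioo_subset_Icc_self hz)))

theorem mul_im_ellipticIntegral_mul_im_nonneg {a x : ℂ} (hx : 1 - x ∈ Complex.slitPlane) {σ : ℝ}
    (ha : ∀ u ∈ Complex.slitPlane, σ * (u ^ a).im * u.im ≤ 0) :
    0 ≤ σ * (ellipticIntegral a x).im * x.im := by
  rw [im_ellipticIntegral a hx, ← intervalIntegral.integral_const_mul,
    ← intervalIntegral.integral_mul_const]
  refine intervalIntegral.integral_nonneg zero_le_one fun z hz => ?_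
  have him : (1 - x * (z : ℂ) ^ 2).im = -(x.im * z ^ 2) := by
    rw [← Complex.ofReal_pow, Complex.sub_im, Complex.im_mul_ofReal]
    simp
  have h := ha _ (one_sub_mul_sq_mem_slitPlane hx hz)
  rw [him] at h
  rw [mul_left_comm, mul_assoc]
  refine mul_nonneg (by positivity) ?_
  rcases eq_or_ne z 0 with rfl | hz0
  · simp
  · have hz2 : 0 < z ^ 2 := by positivity
    by_contra hlt
    push Not at hlt
    nlinarith

theorem one_sub_sq_mul_sq_pos {k z : ℝ} (hk : k ∈ Ioo (-1 : ℝ) 1) (hz : z ∈ Icc (0 : ℝ) 1) :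
    0 < 1 - k ^ 2 * z ^ 2 := by
  have h1 : k ^ 2 < 1 := by nlinarith [hk.1, hk.2]
  have h2 : z ^ 2 ≤ 1 := by nlinarith [hz.1, hz.2]
  nlinarith [sq_nonneg k, sq_nonneg z]

theorem ellipticIntegral_half_eq {k : ℝ} (hk : k ∈ Ioo (-1 : ℝ) 1) :
    ellipticIntegral (1 / 2) ((k : ℂ) ^ 2) = Ec k := by
  rw [ellipticIntegral, Ec, ← intervalIntegral.integral_ofReal]
  refine intervalIntegral.integral_congr fun z hz => ?_
  rw [uIcc_of_le zero_le_one] at hz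
  have h := (one_sub_sq_mul_sq_pos hk hz).le
  have h1 : (1 - (k : ℂ) ^ 2 * (z : ℂ) ^ 2) ^ (1 / 2 : ℂ) =
      (Real.sqrt (1 - k ^ 2 * z ^ 2) : ℂ) := by
    rw [Real.sqrt_eq_rpow, Complex.ofReal_cpow h]
    push_cast
    rfl
  simp only [h1]
  push_cast
  rw [div_eq_inv_mul]

theorem ellipticIntegral_neg_half_eq {k : ℝ} (hk : k ∈ Ioo (-1 : ℝ) 1) :
    ellipticIntegral (-1 / 2) ((k : ℂ) ^ 2) = Kc k := by
  rw [ellipticIntegral, Kc, ← intervalIntegral.integral_ofReal]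
  refine intervalIntegral.integral_congr fun z hz => ?_
  rw [uIcc_of_le zero_le_one] at hz
  have h := (one_sub_sq_mul_sq_pos hk hz).le
  have hz' : 0 ≤ 1 - z ^ 2 := by nlinarith [hz.1, hz.2]
  have h1 : (1 - (k : ℂ) ^ 2 * (z : ℂ) ^ 2) ^ (-1 / 2 : ℂ) =
      ((Real.sqrt (1 - k ^ 2 * z ^ 2))⁻¹ : ℂ) := by
    rw [show (-1 / 2 : ℂ) = -(1 / 2) by ring, Complex.cpow_neg, Real.sqrt_eq_rpow,
      Complex.ofReal_cpow h]
    push_cast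
    rfl
  simp only [h1]
  rw [Real.sqrt_mul hz', one_div, mul_inv]
  push_cast
  rfl

theorem one_sub_sq_mem_slitPlane {k : ℝ} (hk : k ∈ Ioo (-1 : ℝ) 1) :
    1 - (k : ℂ) ^ 2 ∈ Complex.slitPlane := by
  have h := one_sub_sq_mul_sq_pos hk (right_mem_Icc.2 zero_le_one)
  rw [one_pow, mul_one] at h
  exact_mod_cast Complex.ofReal_mem_slitPlane.2 h

theorem analyticAt_re_ellipticIntegral_sq (a : ℂ) {k : ℝ} (hk : k ∈ Ioo (-1 : ℝ) 1) :
    AnalyticAt ℝ (fun t : ℝ => (ellipticIntegral a ((t : ℂ) ^ 2)).re) k := by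
  have h1 : AnalyticAt ℂ (ellipticIntegral a) ((k : ℂ) ^ 2) := by
    rw [Complex.analyticAt_iff_eventually_differentiableAt]
    filter_upwards [isOpen_one_sub_mem_slitPlane.mem_nhds (one_sub_sq_mem_slitPlane hk)] with x hx
    exact differentiableAt_ellipticIntegral a hx
  have h2 : AnalyticAt ℝ (fun t : ℝ => (t : ℂ) ^ 2) k := (Complex.ofRealCLM.analyticAt k).pow 2
  exact (Complex.reCLM.analyticAt _).comp (h1.restrictScalars.comp_of_eq h2 rfl)

theorem analyticAt_Ec {k : ℝ} (hk : k ∈ Ioo (-1 : ℝ) 1) : AnalyticAt ℝ Ec k := by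
  refine (analyticAt_re_ellipticIntegral_sq (1 / 2) hk).congr ?_
  filter_upwards [Ioo_mem_nhds hk.1 hk.2] with t ht
  rw [ellipticIntegral_half_eq ht, Complex.ofReal_re]

theorem analyticAt_Kc {k : ℝ} (hk : k ∈ Ioo (-1 : ℝ) 1) : AnalyticAt ℝ Kc k := by
  refine (analyticAt_re_ellipticIntegral_sq (-1 / 2) hk).congr ?_
  filter_upwards [Ioo_mem_nhds hk.1 hk.2] with t ht
  rw [ellipticIntegral_neg_half_eq ht, Complex.ofReal_re]

theorem re_one_sub_div_one_add_pos {l : ℂ} (hl : ‖l‖ < 1) : 0 < ((1 - l) / (1 + l)).re := by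
  have h0 : 1 + l ≠ 0 := by
    intro h
    rw [eq_neg_of_add_eq_zero_right h, norm_neg, norm_one] at hl
    exact lt_irrefl _ hl
  have h1 : ((1 - l) / (1 + l)).re = (1 - ‖l‖ ^ 2) / Complex.normSq (1 + l) := by
    rw [Complex.sq_norm, Complex.div_re, Complex.normSq_apply l, ← add_div]
    simp only [Complex.sub_re, Complex.add_re, Complex.sub_im, Complex.add_im, Complex.one_re,
      Complex.one_im]
    ring
  rw [h1]
  exact div_pos (by nlinarith [norm_nonneg l]) (Complex.normSq_pos.2 h0)

theorem im_one_sub_div_one_add (l : ℂ) :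
    ((1 - l) / (1 + l)).im = -(2 * l.im / Complex.normSq (1 + l)) := by
  rw [Complex.div_im, ← sub_div, ← neg_div]
  simp only [Complex.sub_re, Complex.add_re, Complex.sub_im, Complex.add_im, Complex.one_re,
    Complex.one_im]
  ring

theorem sq_mem_slitPlane {y : ℂ} (hy : 0 < y.re) : y ^ 2 ∈ Complex.slitPlane := by
  rw [Complex.mem_slitPlane_iff, pow_two, Complex.mul_re, Complex.mul_im]
  rcases eq_or_ne y.im 0 with h | h
  · left
    rw [h]
    nlinarith
  · right
    rw [mul_comm y.im, ← two_mul]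
    exact mul_ne_zero two_ne_zero (mul_ne_zero hy.ne' h)

theorem integral_div_one_sub_mul_map {μ : Measure (Icc (-1 : ℝ) 1)} [IsFiniteMeasure μ]
    {b : Icc (-1 : ℝ) 1 → ℝ} (hb : Measurable b) (k : ℝ) :
    ∫ c, k ^ 2 / (1 - c * k) ∂(μ.map b) = ∫ c, k ^ 2 / (1 - b c * k) ∂μ :=
  integral_map hb.aemeasurable (by fun_prop : Measurable fun c : ℝ =>
    k ^ 2 / (1 - c * k)).aestronglyMeasurable

/-- A function on `ℂ ∖ [1, ∞)` preserving the upper and lower half planes is, after the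
substitution `x = k²`, a Stieltjes-type transform of a finite measure on `[-1, 1]`. -/
theorem exists_measure_re_sq_eq {F : ℂ → ℂ}
    (hF : ∀ x, 1 - x ∈ Complex.slitPlane → DifferentiableAt ℂ F x)
    (him : ∀ x, 1 - x ∈ Complex.slitPlane → 0 ≤ (F x).im * x.im) :
    ∃ (ν : Measure ℝ) (s₀ : ℝ), IsFiniteMeasure ν ∧ (∀ᵐ c ∂ν, c ∈ Icc (-1 : ℝ) 1) ∧
      ∀ k ∈ Ioo (-1 : ℝ) 1, (F ((k : ℂ) ^ 2)).re = s₀ + ∫ c, k ^ 2 / (1 - c * k) ∂ν := by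
  set ξ : ℂ → ℂ := fun l => 1 - ((1 - l) / (1 + l)) ^ 2 with hξ
  have hslit : ∀ l ∈ Metric.ball (0 : ℂ) 1, 1 - ξ l ∈ Complex.slitPlane := by
    intro l hl
    rw [hξ, sub_sub_cancel]
    exact sq_mem_slitPlane (re_one_sub_div_one_add_pos (mem_ball_zero_iff.1 hl))
  have hgd : DifferentiableOn ℂ (fun l => F (ξ l)) (Metric.ball 0 1) := by
    intro l hl
    have h0 : 1 + l ≠ 0 := by
      intro h
      rw [mem_ball_zero_iff, eq_neg_of_add_eq_zero_right h, norm_neg, norm_one] at hl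
      exact lt_irrefl _ hl
    have h1 : DifferentiableAt ℂ ξ l :=
      (((differentiableAt_id.const_sub 1).div (differentiableAt_id.const_add 1) h0).pow 2).const_sub
        1
    exact ((hF _ (hslit l hl)).comp l h1).differentiableWithinAt
  have hgim : ∀ l ∈ Metric.ball (0 : ℂ) 1, 0 ≤ (F (ξ l)).im * l.im := by
    intro l hl
    have h1 := him _ (hslit l hl)
    have h2 := re_one_sub_div_one_add_pos (mem_ball_zero_iff.1 hl)
    have h3 : (ξ l).im = 4 * ((1 - l) / (1 + l)).re / Complex.normSq (1 + l) * l.im := by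
      rw [hξ, Complex.sub_im, pow_two, Complex.mul_im, im_one_sub_div_one_add, Complex.one_im]
      ring
    rw [h3] at h1
    rcases eq_or_ne l.im 0 with h | h
    · rw [h, mul_zero]
    · have h4 : 0 < Complex.normSq (1 + l) := by
        refine Complex.normSq_pos.2 fun h0 => h ?_
        simpa using congrArg Complex.im h0
      have h5 : 0 < 4 * ((1 - l) / (1 + l)).re / Complex.normSq (1 + l) := by positivity
      by_contra hlt
      push Not at hlt
      nlinarith
  obtain ⟨μ, hμ, hrep⟩ := exists_measure_of_im_mul_im_nonneg hgd hgim
  set b : Icc (-1 : ℝ) 1 → ℝ := fun c => Real.sqrt ((1 + (c : ℝ)) / 2) with hb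
  have hbm : Measurable b := by fun_prop
  have hbn : Measurable fun c => -b c := hbm.neg
  have hb1 : ∀ c, b c ∈ Icc (0 : ℝ) 1 := fun c =>
    ⟨Real.sqrt_nonneg _, Real.sqrt_le_one.2 (by linarith [c.2.2])⟩
  set ν₁ := μ.map b with hν₁
  set ν₂ := μ.map fun c => -b c with hν₂
  have hae₁ : ∀ᵐ c ∂ν₁, c ∈ Icc (-1 : ℝ) 1 :=
    (ae_map_iff hbm.aemeasurable measurableSet_Icc).2 (Eventually.of_forall fun c =>
      ⟨by linarith [(hb1 c).1], (hb1 c).2⟩)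
  have hae₂ : ∀ᵐ c ∂ν₂, c ∈ Icc (-1 : ℝ) 1 :=
    (ae_map_iff hbn.aemeasurable measurableSet_Icc).2 (Eventually.of_forall fun c =>
      ⟨neg_le_neg (hb1 c).2, by linarith [(hb1 c).1]⟩)
  have hfin₁ : IsFiniteMeasure ν₁ := by rw [hν₁]; infer_instance
  have hfin₂ : IsFiniteMeasure ν₂ := by rw [hν₂]; infer_instance
  refine ⟨(8⁻¹ : NNReal) • (ν₁ + ν₂), (F (ξ 0)).re, inferInstance, ?_, fun k hk => ?_⟩
  · exact Measure.ae_smul_measure (ae_add_measure_iff.2 ⟨hae₁, hae₂⟩) _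
  · set r := Real.sqrt (1 - k ^ 2) with hr
    have hk2 : k ^ 2 < 1 := by nlinarith [hk.1, hk.2]
    have hr0 : 0 < r := Real.sqrt_pos.2 (by linarith)
    have hr2 : r ^ 2 = 1 - k ^ 2 := Real.sq_sqrt (by linarith)
    have hs : (1 - r) / (1 + r) ∈ Ioo (-1 : ℝ) 1 := by
      constructor
      · rw [lt_div_iff₀ (by linarith)]; linarith
      · rw [div_lt_one (by linarith)]; linarith
    have h1 := hrep _ hs
    have hξs : ξ (((1 - r) / (1 + r) : ℝ) : ℂ) = (k : ℂ) ^ 2 := by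
      have h2 : (1 - (1 - r) / (1 + r)) / (1 + (1 - r) / (1 + r)) = r := by
        have : 1 + r ≠ 0 := by linarith
        field_simp
        ring
      have h3 : 1 - ((1 - (1 - r) / (1 + r)) / (1 + (1 - r) / (1 + r))) ^ 2 = k ^ 2 := by
        rw [h2, hr2]; ring
      simp only [hξ]
      exact_mod_cast congrArg Complex.ofReal h3
    simp only [hξs] at h1
    rw [h1]
    congr 1
    have hcont : ∀ k ∈ Ioo (-1 : ℝ) 1, ContinuousOn (fun c : ℝ => k ^ 2 / (1 - c * k))
        (Icc (-1) 1) := fun k hk =>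
      continuousOn_const.div (by fun_prop) fun c hc => (one_sub_mul_pos hc hk).ne'
    have hi₁ := integrable_of_continuousOn_Icc hae₁ (hcont k hk)
    have hi₂ := integrable_of_continuousOn_Icc hae₂ (hcont k hk)
    have hj₁ : Integrable (fun c => k ^ 2 / (1 - b c * k)) μ := hi₁.comp_measurable hbm
    have hj₂ : Integrable (fun c => k ^ 2 / (1 - -b c * k)) μ := hi₂.comp_measurable hbn
    rw [integral_smul_nnreal_measure, integral_add_measure hi₁ hi₂, hν₁, hν₂,
      integral_div_one_sub_mul_map hbm, integral_div_one_sub_mul_map hbn,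
      ← integral_add hj₁ hj₂, NNReal.smul_def, smul_eq_mul,
      ← integral_const_mul]
    refine integral_congr_ae (Eventually.of_forall fun c => ?_)
    have hbsq : b c ^ 2 = (1 + (c : ℝ)) / 2 := Real.sq_sqrt (by linarith [c.2.1])
    have hd1 : 1 - b c * k ≠ 0 :=
      (one_sub_mul_pos ⟨by linarith [(hb1 c).1], (hb1 c).2⟩ hk).ne'
    have hd2 : 1 - -b c * k ≠ 0 :=
      (one_sub_mul_pos ⟨neg_le_neg (hb1 c).2, by linarith [(hb1 c).1]⟩ hk).ne'
    have hd3 := (one_sub_two_mul_add_sq_pos c.2 hs).ne'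
    have hr1 : 1 + r ≠ 0 := by linarith
    have hc' : (c : ℝ) = 2 * b c ^ 2 - 1 := by linarith
    have hd4 : 1 - 2 * (c : ℝ) * ((1 - r) / (1 + r)) + ((1 - r) / (1 + r)) ^ 2 =
        4 * ((1 - b c * k) * (1 - -b c * k)) / (1 + r) ^ 2 := by
      rw [hc']
      field_simp
      linear_combination (2 + 2 * (2 * b c ^ 2 - 1)) * hr2
    simp only [NNReal.coe_inv, NNReal.coe_ofNat]
    rw [hd4]
    rw [neg_mul, sub_neg_eq_add] at hd2 ⊢
    field_simp
    linear_combination (-8) * hr2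

theorem isBigO_pow_zeroMult {f : ℝ → ℝ} {x : ℝ} (hf : AnalyticAt ℝ f x) :
    f =O[𝓝 x] fun k => (k - x) ^ zeroMult f x := by
  have h1 : (zeroMult f x : ℕ∞) ≤ analyticOrderAt f x := by
    rw [natCast_le_analyticOrderAt_iff_iteratedDeriv_eq_zero hf]
    intro i hi
    have h2 := Nat.notMem_of_lt_sInf hi
    simpa using h2
  obtain ⟨g, hg, hfg⟩ := (natCast_le_analyticOrderAt hf).1 h1
  have h2 := (Asymptotics.isBigO_refl (fun k : ℝ => (k - x) ^ zeroMult f x) (𝓝 x)).mul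
    (hg.continuousAt.tendsto.isBigO_one ℝ)
  simp only [mul_one] at h2
  exact h2.congr' (hfg.mono fun k hk => hk.symm) EventuallyEq.rfl

theorem exists_polynomial_mul_eq_of_ae_mem_finite {ν : Measure ℝ} [IsFiniteMeasure ν]
    (hν : ∀ᵐ c ∂ν, c ∈ Icc (-1 : ℝ) 1) {S : ℝ → ℝ} {s₀ : ℝ}
    (hS : ∀ k ∈ Ioo (-1 : ℝ) 1, S k = s₀ + ∫ c, k ^ 2 / (1 - c * k) ∂ν)
    {s : Set ℝ} (hs : s.Finite) (hsν : ∀ᵐ c ∂ν, c ∈ s) :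
    ∃ A B : ℝ[X], A ≠ 0 ∧ ∀ k ∈ Ioo (-1 : ℝ) 1, A.eval k * S k = B.eval k := by
  classical
  set t : Finset ℝ := (hs.inter_of_left (Icc (-1 : ℝ) 1)).toFinset with ht
  have htν : ∀ᵐ c ∂ν, c ∈ (t : Set ℝ) := by
    filter_upwards [hν, hsν] with c h1 h2
    simp only [ht, Finite.coe_toFinset]
    exact ⟨h2, h1⟩
  have htI : ∀ c ∈ t, c ∈ Icc (-1 : ℝ) 1 := fun c hc => ((Finite.mem_toFinset _).1 hc).2
  refine ⟨∏ c ∈ t, (1 - C c * X), C s₀ * ∏ c ∈ t, (1 - C c * X) +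
    ∑ c ∈ t, C (ν.real {c}) * X ^ 2 * ∏ d ∈ t.erase c, (1 - C d * X), ?_, fun k hk => ?_⟩
  · intro h
    have h1 := congrArg (eval 0) h
    simp [eval_prod] at h1
  · have h1 : ∫ c, k ^ 2 / (1 - c * k) ∂ν = ∑ c ∈ t, ν.real {c} * (k ^ 2 / (1 - c * k)) := by
      have hi : Integrable (fun c : ℝ => k ^ 2 / (1 - c * k)) ν :=
        integrable_of_continuousOn_Icc hν (continuousOn_const.div (by fun_prop)
          fun c hc => (one_sub_mul_pos hc hk).ne')
      conv_lhs => rw [← Measure.restrict_eq_self_of_ae_mem htν]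
      rw [setIntegral_finset t hi.integrableOn]
      simp only [smul_eq_mul]
    rw [hS k hk, h1]
    simp only [eval_add, eval_mul, eval_prod, eval_sub, eval_one, eval_C, eval_X, eval_finsetSum,
      eval_pow]
    rw [mul_add, Finset.mul_sum, mul_comm s₀]
    congr 1
    refine Finset.sum_congr rfl fun c hc => ?_
    have h2 := (one_sub_mul_pos (htI c hc) hk).ne'
    rw [← Finset.mul_prod_erase t (fun d => 1 - d * k) hc]
    field_simp

theorem continuousOn_sqrt_one_sub (k : ℝ) :
    ContinuousOn (fun z : ℝ => Real.sqrt (1 - k ^ 2 * z ^ 2)) (uIcc 0 1) := by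
  fun_prop

theorem continuousOn_inv_sqrt_one_sub {k : ℝ} (hk : k ∈ Ioo (-1 : ℝ) 1) :
    ContinuousOn (fun z : ℝ => (Real.sqrt (1 - k ^ 2 * z ^ 2))⁻¹) (uIcc 0 1) := by
  refine (continuousOn_sqrt_one_sub k).inv₀ fun z hz => ?_
  rw [uIcc_of_le zero_le_one] at hz
  exact (Real.sqrt_pos.2 (one_sub_sq_mul_sq_pos hk hz)).ne'

theorem Ec_eq (k : ℝ) :
    Ec k = ∫ z in (0 : ℝ)..1, (Real.sqrt (1 - z ^ 2))⁻¹ * Real.sqrt (1 - k ^ 2 * z ^ 2) := by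
  simp only [Ec, div_eq_inv_mul]

theorem Kc_eq (k : ℝ) :
    Kc k = ∫ z in (0 : ℝ)..1, (Real.sqrt (1 - z ^ 2))⁻¹ * (Real.sqrt (1 - k ^ 2 * z ^ 2))⁻¹ := by
  refine intervalIntegral.integral_congr fun z hz => ?_
  rw [uIcc_of_le zero_le_one] at hz
  have hz' : 0 ≤ 1 - z ^ 2 := by nlinarith [hz.1, hz.2]
  simp only [Real.sqrt_mul hz', one_div, mul_inv]

theorem one_le_Ec {k : ℝ} (hk : k ∈ Ioo (-1 : ℝ) 1) : 1 ≤ Ec k := by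
  have h : ∫ _ in (0 : ℝ)..1, (1 : ℝ) = 1 := by simp
  refine h.symm.le.trans ?_
  rw [Ec_eq]
  refine intervalIntegral.integral_mono_on_of_le_Ioo zero_le_one intervalIntegrable_const
    (intervalIntegrable_inv_sqrt_one_sub_sq.mul_continuousOn (continuousOn_sqrt_one_sub k)) ?_
  intro z hz
  have h1 : 0 < 1 - z ^ 2 := by nlinarith [hz.1, hz.2]
  have h2 : k ^ 2 < 1 := by nlinarith [hk.1, hk.2]
  rw [inv_mul_eq_div, one_le_div (Real.sqrt_pos.2 h1)]
  exact Real.sqrt_le_sqrt (by nlinarith [sq_nonneg z])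

theorem Ec_le (k : ℝ) : Ec k ≤ ∫ z in (0 : ℝ)..1, (Real.sqrt (1 - z ^ 2))⁻¹ := by
  rw [Ec_eq]
  refine intervalIntegral.integral_mono_on zero_le_one
    (intervalIntegrable_inv_sqrt_one_sub_sq.mul_continuousOn (continuousOn_sqrt_one_sub k))
    intervalIntegrable_inv_sqrt_one_sub_sq fun z _ => ?_
  exact mul_le_of_le_one_right (by positivity)
    (Real.sqrt_le_one.2 (by nlinarith [sq_nonneg (k * z)]))

theorem Kc_le {k : ℝ} (hk : k ∈ Ioo (0 : ℝ) 1) :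
    Kc k ≤ (∫ z in (0 : ℝ)..1, (Real.sqrt (1 - z ^ 2))⁻¹) * (Real.sqrt (1 - k))⁻¹ := by
  have hk' : k ∈ Ioo (-1 : ℝ) 1 := ⟨by linarith [hk.1], hk.2⟩
  rw [Kc_eq, ← intervalIntegral.integral_mul_const]
  refine intervalIntegral.integral_mono_on zero_le_one
    (intervalIntegrable_inv_sqrt_one_sub_sq.mul_continuousOn (continuousOn_inv_sqrt_one_sub hk'))
    (intervalIntegrable_inv_sqrt_one_sub_sq.mul_const _) fun z hz => ?_
  have h1 : z ^ 2 ≤ 1 := by nlinarith [hz.1, hz.2]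
  have h2 : k ^ 2 ≤ k := by nlinarith [hk.1, hk.2]
  refine mul_le_mul_of_nonneg_left (inv_anti₀ (Real.sqrt_pos.2 (by linarith [hk.2]))
    (Real.sqrt_le_sqrt ?_)) (by positivity)
  nlinarith [sq_nonneg k]

theorem neg_log_one_sub_le_two_mul_Kc {k : ℝ} (hk : k ∈ Ioo (0 : ℝ) 1) :
    -Real.log (1 - k) ≤ 2 * Kc k := by
  have hk' : k ∈ Ioo (-1 : ℝ) 1 := ⟨by linarith [hk.1], hk.2⟩
  have hpos : ∀ z ∈ Icc (0 : ℝ) 1, 0 < 1 - k * z := by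
    intro z hz
    nlinarith [hz.1, hz.2, hk.1, hk.2]
  have hcont : ContinuousOn (fun z : ℝ => k / (1 - k * z)) (uIcc 0 1) := by
    rw [uIcc_of_le zero_le_one]
    exact continuousOn_const.div (by fun_prop) fun z hz => (hpos z hz).ne'
  have h1 : ∫ z in (0 : ℝ)..1, k / (1 - k * z) = -Real.log (1 - k) := by
    rw [intervalIntegral.integral_eq_sub_of_hasDerivAt (f := fun z => -Real.log (1 - k * z))
      (fun z hz => ?_) hcont.intervalIntegrable]
    · simp
    · rw [uIcc_of_le zero_le_one] at hz
      have h2 : HasDerivAt (fun z : ℝ => 1 - k * z) (-k) z := by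
        simpa using ((hasDerivAt_id z).const_mul k).const_sub 1
      have h3 := (h2.log (hpos z hz).ne').neg
      rw [neg_div, neg_neg] at h3
      exact h3
  rw [← h1, Kc_eq, ← intervalIntegral.integral_const_mul]
  refine intervalIntegral.integral_mono_on_of_le_Ioo zero_le_one hcont.intervalIntegrable
    ((intervalIntegrable_inv_sqrt_one_sub_sq.mul_continuousOn
      (continuousOn_inv_sqrt_one_sub hk')).const_mul 2) ?_
  intro z hz
  have hz1 : 0 < 1 - z ^ 2 := by nlinarith [hz.1, hz.2]
  have hk2 : k ^ 2 < 1 := by nlinarith [hk.1, hk.2]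
  have hz2 := one_sub_sq_mul_sq_pos hk' (Ioo_subset_Icc_self hz)
  have h3 : Real.sqrt (1 - z ^ 2) ≤ Real.sqrt (1 - k ^ 2 * z ^ 2) :=
    Real.sqrt_le_sqrt (by nlinarith [sq_nonneg z])
  have h4 : Real.sqrt (1 - z ^ 2) * Real.sqrt (1 - k ^ 2 * z ^ 2) ≤ 1 - k ^ 2 * z ^ 2 := by
    calc _ ≤ Real.sqrt (1 - k ^ 2 * z ^ 2) * Real.sqrt (1 - k ^ 2 * z ^ 2) :=
          mul_le_mul_of_nonneg_right h3 (Real.sqrt_nonneg _)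
      _ = _ := Real.mul_self_sqrt hz2.le
  have h5 := hpos z (Ioo_subset_Icc_self hz)
  have h6 : k * z < 1 := by linarith
  rw [← mul_inv, ← div_eq_mul_inv, div_le_div_iff₀ h5
    (mul_pos (Real.sqrt_pos.2 hz1) (Real.sqrt_pos.2 hz2))]
  have h7 : 0 < k * z := mul_pos hk.1 hz.1
  calc k * (Real.sqrt (1 - z ^ 2) * Real.sqrt (1 - k ^ 2 * z ^ 2))
      ≤ 1 * (1 - k ^ 2 * z ^ 2) :=
        mul_le_mul hk.2.le h4 (by positivity) zero_le_one
    _ ≤ 2 * (1 - k * z) := by nlinarith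

theorem Ioo_zero_one_mem_nhdsLT_one : Ioo (0 : ℝ) 1 ∈ 𝓝[<] (1 : ℝ) := Ioo_mem_nhdsLT zero_lt_one

theorem tendsto_one_sub_nhdsLT_one : Tendsto (fun k : ℝ => 1 - k) (𝓝[<] 1) (𝓝[>] 0) := by
  refine tendsto_nhdsWithin_iff.2 ⟨?_, ?_⟩
  · have h : Continuous fun k : ℝ => 1 - k := by fun_prop
    simpa using (h.tendsto 1).mono_left nhdsWithin_le_nhds
  · filter_upwards [self_mem_nhdsWithin] with k hk
    exact sub_pos.2 (mem_Iio.1 hk)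

theorem tendsto_Kc_atTop : Tendsto Kc (𝓝[<] 1) atTop := by
  have h1 : Tendsto (fun k : ℝ => -Real.log (1 - k) / 2) (𝓝[<] 1) atTop :=
    (tendsto_neg_atBot_atTop.comp (Real.tendsto_log_nhdsGT_zero.comp
      tendsto_one_sub_nhdsLT_one)).atTop_div_const two_pos
  refine tendsto_atTop_mono' _ ?_ h1
  filter_upwards [Ioo_zero_one_mem_nhdsLT_one] with k hk
  linarith [neg_log_one_sub_le_two_mul_Kc hk]

theorem tendsto_one_sub_mul_Kc : Tendsto (fun k => (1 - k) * Kc k) (𝓝[<] 1) (𝓝 0) := by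
  set A := ∫ z in (0 : ℝ)..1, (Real.sqrt (1 - z ^ 2))⁻¹ with hA
  have h1 : Tendsto (fun k : ℝ => A * Real.sqrt (1 - k)) (𝓝[<] 1) (𝓝 0) := by
    have h := ((Real.continuous_sqrt.tendsto 0).comp
      (tendsto_one_sub_nhdsLT_one.mono_right nhdsWithin_le_nhds)).const_mul A
    simpa using h
  refine squeeze_zero' ?_ ?_ h1
  · filter_upwards [Ioo_zero_one_mem_nhdsLT_one,
      tendsto_Kc_atTop.eventually_ge_atTop 0] with k hk h0
    exact mul_nonneg (by linarith [hk.2]) h0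
  · filter_upwards [Ioo_zero_one_mem_nhdsLT_one] with k hk
    have h2 : 0 < 1 - k := by linarith [hk.2]
    have h3 := mul_le_mul_of_nonneg_left (Kc_le hk) h2.le
    refine h3.trans_eq ?_
    rw [mul_left_comm, ← div_eq_mul_inv, Real.div_sqrt]

theorem isBigO_Ec_one : Ec =O[𝓝[<] 1] fun _ => (1 : ℝ) := by
  refine Asymptotics.IsBigO.of_bound (∫ z in (0 : ℝ)..1, (Real.sqrt (1 - z ^ 2))⁻¹) ?_
  filter_upwards [Ioo_zero_one_mem_nhdsLT_one] with k hk
  have h1 := one_le_Ec (k := k) ⟨by linarith [hk.1], hk.2⟩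
  rw [norm_one, mul_one, Real.norm_of_nonneg (by linarith)]
  exact Ec_le k

/-- The complete elliptic integrals are linearly independent over the polynomials. -/
theorem eq_zero_of_eval_mul_Kc_eq {A B : ℝ[X]}
    (h : ∀ k ∈ Ioo (0 : ℝ) 1, A.eval k * Kc k = B.eval k * Ec k) : A = 0 := by
  induction hn : A.natDegree using Nat.strong_induction_on generalizing A B with
  | _ n ih =>
  have hev : ∀ᶠ k in 𝓝[<] (1 : ℝ), A.eval k * Kc k = B.eval k * Ec k := by
    filter_upwards [Ioo_zero_one_mem_nhdsLT_one] with k hk using h k hk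
  have hpol : ∀ f : ℝ[X], Tendsto (fun k => f.eval k) (𝓝[<] 1) (𝓝 (f.eval 1)) := fun f =>
    f.continuous.continuousAt.tendsto.mono_left nhdsWithin_le_nhds
  by_cases hA1 : A.eval 1 = 0
  · obtain ⟨A', rfl⟩ := dvd_iff_isRoot.2 hA1
    have hB0 : Tendsto (fun k => B.eval k * Ec k) (𝓝[<] 1) (𝓝 0) := by
      have h1 := (hpol A').mul tendsto_one_sub_mul_Kc.neg
      rw [neg_zero, mul_zero] at h1
      refine h1.congr' (hev.mono fun k hk => ?_)
      beta_reduce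
      rw [← hk, eval_mul, eval_sub, eval_X, eval_C]
      ring
    have hB1 : B.eval 1 = 0 := by
      refine tendsto_nhds_unique (hpol B)
        (squeeze_zero_norm' (a := fun k => ‖B.eval k * Ec k‖) ?_ ?_)
      · filter_upwards [Ioo_zero_one_mem_nhdsLT_one] with k hk
        have h1 := one_le_Ec (k := k) ⟨by linarith [hk.1], hk.2⟩
        rw [norm_mul, Real.norm_of_nonneg (by linarith : 0 ≤ Ec k)]
        exact le_mul_of_one_le_right (norm_nonneg _) h1
      · simpa using hB0.norm
    obtain ⟨B', rfl⟩ := dvd_iff_isRoot.2 hB1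
    by_cases hA' : A' = 0
    · rw [hA', mul_zero]
    · rw [ih A'.natDegree ?_ (A := A') (B := B') ?_ rfl, mul_zero]
      · rw [← hn, natDegree_mul (X_sub_C_ne_zero 1) hA', natDegree_X_sub_C]
        omega
      · intro k hk
        have h1 := h k hk
        simp only [eval_mul, eval_sub, eval_X, eval_C, mul_assoc] at h1
        exact mul_left_cancel₀ (sub_ne_zero.2 hk.2.ne) h1
  · exfalso
    have h1 : (fun k => (A.eval k)⁻¹ * (B.eval k * Ec k)) =O[𝓝[<] 1] fun _ => (1 : ℝ) := by
      simpa using (((hpol A).inv₀ hA1).isBigO_one ℝ).mul (((hpol B).isBigO_one ℝ).mul isBigO_Ec_one)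
    have h2 : Kc =O[𝓝[<] 1] fun _ => (1 : ℝ) := by
      refine h1.congr' ?_ EventuallyEq.rfl
      filter_upwards [hev, (hpol A).eventually_ne hA1] with k hk hk0
      rw [← hk, inv_mul_cancel_left₀ hk0]
    exact not_isBoundedUnder_of_tendsto_atTop (tendsto_norm_atTop_atTop.comp tendsto_Kc_atTop)
      ((Asymptotics.isBigO_one_iff ℝ).1 h2)

theorem im_div_mul_nonneg {z w : ℂ} {t : ℝ} (hz : 0 < z.re) (hw : 0 < w.re) (hzt : 0 ≤ z.im * t)
    (hwt : w.im * t ≤ 0) : 0 ≤ (z / w).im * t := by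
  have h : (z / w).im * t = (z.im * t * w.re - z.re * (w.im * t)) / Complex.normSq w := by
    rw [Complex.div_im]
    ring
  rw [h]
  refine div_nonneg ?_ (Complex.normSq_nonneg w)
  nlinarith [mul_nonneg hzt hw.le, mul_nonneg hz.le (neg_nonneg.2 hwt)]

theorem re_ellipticIntegral_half_pos {x : ℂ} (hx : 1 - x ∈ Complex.slitPlane) :
    0 < (ellipticIntegral (1 / 2) x).re :=
  re_ellipticIntegral_pos hx fun _ => re_cpow_half_pos

theorem re_ellipticIntegral_neg_half_pos {x : ℂ} (hx : 1 - x ∈ Complex.slitPlane) :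
    0 < (ellipticIntegral (-1 / 2) x).re :=
  re_ellipticIntegral_pos hx fun _ => re_cpow_neg_half_pos

theorem im_ellipticIntegral_half_mul_im_nonpos {x : ℂ} (hx : 1 - x ∈ Complex.slitPlane) :
    (ellipticIntegral (1 / 2) x).im * x.im ≤ 0 := by
  have h := mul_im_ellipticIntegral_mul_im_nonneg (a := 1 / 2) (σ := -1) hx fun u hu => by
    linarith [im_cpow_half_mul_im_nonneg hu]
  linarith

theorem im_ellipticIntegral_neg_half_mul_im_nonneg {x : ℂ} (hx : 1 - x ∈ Complex.slitPlane) :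
    0 ≤ (ellipticIntegral (-1 / 2) x).im * x.im := by
  have h := mul_im_ellipticIntegral_mul_im_nonneg (a := -1 / 2) (σ := 1) hx fun u hu => by
    linarith [im_cpow_neg_half_mul_im_nonpos hu]
  linarith

theorem ellipticIntegral_ne_zero_of_re_pos {a x : ℂ} (h : 0 < (ellipticIntegral a x).re) :
    ellipticIntegral a x ≠ 0 := fun h0 => by simp [h0] at h

theorem Kc_pos {k : ℝ} (hk : k ∈ Ioo (-1 : ℝ) 1) : 0 < Kc k := by
  have h := re_ellipticIntegral_neg_half_pos (one_sub_sq_mem_slitPlane hk)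
  rwa [ellipticIntegral_neg_half_eq hk, Complex.ofReal_re] at h

/-- If `F` maps the upper half plane into itself and is holomorphic and real off `[1, ∞)`, then a
nontrivial combination of `1` and `k ↦ F (k ^ 2)` with polynomial coefficients has few zeros. -/
theorem sum_le_of_isBigO_eval_add_eval_mul {F : ℂ → ℂ}
    (hF : ∀ x, 1 - x ∈ Complex.slitPlane → DifferentiableAt ℂ F x)
    (him : ∀ x, 1 - x ∈ Complex.slitPlane → 0 ≤ (F x).im * x.im) {S : ℝ → ℝ}
    (hFS : ∀ k ∈ Ioo (-1 : ℝ) 1, F ((k : ℂ) ^ 2) = S k)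
    (hS : ∀ A B : ℝ[X], (∀ k ∈ Ioo (-1 : ℝ) 1, A.eval k * S k = B.eval k) → A = 0)
    {P Q : ℝ[X]} {M n : ℕ} (hP : P.natDegree ≤ M) (hQ : Q.natDegree ≤ n) (hnM : n ≤ M)
    (hPQ : ¬(P = 0 ∧ Q = 0)) {T : Finset ℝ} {e : ℝ → ℕ} (hT : ∀ x ∈ T, x ∈ Ioo (-1 : ℝ) 1)
    (hO : ∀ x ∈ T, (fun k => P.eval k + Q.eval k * S k) =O[𝓝 x] fun k => (k - x) ^ e x) :
    ∑ x ∈ T, e x ≤ M + n + 2 := by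
  by_contra! hN
  by_cases hQ0 : Q = 0
  · refine hPQ ⟨eq_zero_of_isBigO_of_degree_lt (T := T) (e := e) ?_ fun x hx => ?_, hQ0⟩
    · exact degree_le_natDegree.trans_lt (by exact_mod_cast (by omega))
    · simpa [hQ0] using hO x hx
  · obtain ⟨ν, s₀, hfin, hν, hSν⟩ := exists_measure_re_sq_eq hF him
    have hSν' : ∀ k ∈ Ioo (-1 : ℝ) 1, S k = s₀ + ∫ c, k ^ 2 / (1 - c * k) ∂ν := by
      intro k hk
      rw [← hSν k hk, hFS k hk, Complex.ofReal_re]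
    have hae := ae_mul_eval_reflect_eq_zero hν hSν' hP hQ hnM hT hN hO
    have hne : X * Q.reflect n ≠ 0 :=
      mul_ne_zero X_ne_zero fun h => hQ0 (reflect_eq_zero_iff.1 h)
    obtain ⟨A, B, hA, hAB⟩ := exists_polynomial_mul_eq_of_ae_mem_finite hν hSν'
      (s := {c | (X * Q.reflect n).IsRoot c}) (finite_setOfPred_isRoot hne)
      (hae.mono fun c hc => by simpa using hc)
    exact hA (hS A B hAB)

theorem isBigO_eval_add_eval_mul_div {P Q : ℝ[X]} {N D φ g : ℝ → ℝ} {x : ℝ}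
    (hx : x ∈ Ioo (-1 : ℝ) 1) (hD : ContinuousAt D x) (hD0 : ∀ k ∈ Ioo (-1 : ℝ) 1, D k ≠ 0)
    (hφ : ∀ k, φ k = P.eval k * D k + Q.eval k * N k) (h : φ =O[𝓝 x] g) :
    (fun k => P.eval k + Q.eval k * (N k / D k)) =O[𝓝 x] g := by
  have h1 := h.mul ((hD.inv₀ (hD0 x hx)).tendsto.isBigO_one ℝ)
  simp only [mul_one] at h1
  refine h1.congr' ?_ EventuallyEq.rfl
  filter_upwards [Ioo_mem_nhds hx.1 hx.2] with k hk
  have h2 := hD0 k hk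
  rw [hφ, Pi.inv_apply]
  field_simp

/-- if `deg p ≤ m`, `deg q ≤ n` and `p`, `q` are not both zero, then
`I(k) = p(k)·K(k) + q(k)·E(k)` has at most `m + n + 2` zeros in `(-1,1)`,
counted with multiplicity. -/
theorem zeros_of_pK_qE (m n : ℕ) (p q : Polynomial ℝ)
    (hp : p.natDegree ≤ m) (hq : q.natDegree ≤ n) (hpq : ¬(p = 0 ∧ q = 0)) :
    ∀ T : Finset ℝ,
      (∀ x ∈ T, x ∈ Set.Ioo (-1 : ℝ) 1 ∧ p.eval x * Kc x + q.eval x * Ec x = 0) →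
      ∑ x ∈ T, zeroMult (fun k => p.eval k * Kc k + q.eval k * Ec k) x ≤ m + n + 2 := by
  intro T hT
  have hT' : ∀ x ∈ T, x ∈ Ioo (-1 : ℝ) 1 := fun x hx => (hT x hx).1
  have hIoo : ∀ k ∈ Ioo (0 : ℝ) 1, k ∈ Ioo (-1 : ℝ) 1 := fun k hk => ⟨by linarith [hk.1], hk.2⟩
  have hEpos : ∀ k ∈ Ioo (-1 : ℝ) 1, 0 < Ec k := fun k hk => zero_lt_one.trans_le (one_le_Ec hk)
  have hO : ∀ x ∈ T, (fun k => p.eval k * Kc k + q.eval k * Ec k) =O[𝓝 x] fun k =>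
      (k - x) ^ zeroMult (fun k => p.eval k * Kc k + q.eval k * Ec k) x := fun x hx =>
    isBigO_pow_zeroMult (((AnalyticOnNhd.eval_polynomial p x (mem_univ x)).mul
      (analyticAt_Kc (hT' x hx))).add ((AnalyticOnNhd.eval_polynomial q x (mem_univ x)).mul
      (analyticAt_Ec (hT' x hx))))
  rcases le_total m n with hmn | hmn
  · rw [add_comm m n]
    refine sum_le_of_isBigO_eval_add_eval_mul (P := q) (Q := p) (S := fun k => Kc k / Ec k)
      (F := fun x => ellipticIntegral (-1 / 2) x / ellipticIntegral (1 / 2) x)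
      (fun x hx => (differentiableAt_ellipticIntegral _ hx).div
        (differentiableAt_ellipticIntegral _ hx)
        (ellipticIntegral_ne_zero_of_re_pos (re_ellipticIntegral_half_pos hx)))
      (fun x hx => im_div_mul_nonneg (re_ellipticIntegral_neg_half_pos hx)
        (re_ellipticIntegral_half_pos hx) (im_ellipticIntegral_neg_half_mul_im_nonneg hx)
        (im_ellipticIntegral_half_mul_im_nonpos hx))
      (fun k hk => ?_) (fun A B h => ?_) hq hp hmn (fun h => hpq h.symm) hT'
      fun x hx => isBigO_eval_add_eval_mul_div (hT' x hx)
        (analyticAt_Ec (hT' x hx)).continuousAt (fun k hk => (hEpos k hk).ne')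
        (fun k => add_comm _ _) (hO x hx)
    · simp only [ellipticIntegral_half_eq hk, ellipticIntegral_neg_half_eq hk, Complex.ofReal_div]
    · refine eq_zero_of_eval_mul_Kc_eq (B := B) fun k hk => ?_
      rw [← h k (hIoo k hk), mul_assoc, div_mul_cancel₀ _ (hEpos k (hIoo k hk)).ne']
  · refine sum_le_of_isBigO_eval_add_eval_mul (P := p) (Q := -q) (S := fun k => -Ec k / Kc k)
      (F := fun x => -(ellipticIntegral (1 / 2) x / ellipticIntegral (-1 / 2) x))
      (fun x hx => ((differentiableAt_ellipticIntegral _ hx).div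
        (differentiableAt_ellipticIntegral _ hx)
        (ellipticIntegral_ne_zero_of_re_pos (re_ellipticIntegral_neg_half_pos hx))).neg)
      (fun x hx => ?_) (fun k hk => ?_) (fun A B h => ?_) hp (by rwa [natDegree_neg]) hmn
      (fun h => hpq ⟨h.1, neg_eq_zero.1 h.2⟩) hT'
      fun x hx => isBigO_eval_add_eval_mul_div (hT' x hx)
        (analyticAt_Kc (hT' x hx)).continuousAt (fun k hk => (Kc_pos hk).ne')
        (fun k => by rw [eval_neg, neg_mul_neg]) (hO x hx)
    · have h := im_div_mul_nonneg (t := -x.im) (re_ellipticIntegral_half_pos hx)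
        (re_ellipticIntegral_neg_half_pos hx)
        (by linarith [im_ellipticIntegral_half_mul_im_nonpos hx])
        (by linarith [im_ellipticIntegral_neg_half_mul_im_nonneg hx])
      rwa [mul_neg, ← neg_mul, ← Complex.neg_im] at h
    · simp only [ellipticIntegral_half_eq hk, ellipticIntegral_neg_half_eq hk, Complex.ofReal_div,
        Complex.ofReal_neg]
      rw [neg_div]
    · have hBA : ∀ k ∈ Ioo (0 : ℝ) 1, B.eval k * Kc k = (-A).eval k * Ec k := by
        intro k hk
        rw [← h k (hIoo k hk), mul_assoc, div_mul_cancel₀ _ (Kc_pos (hIoo k hk)).ne', eval_neg,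
          neg_mul, mul_neg]
      have hB := eq_zero_of_eval_mul_Kc_eq hBA
      refine eq_zero_of_infinite_isRoot A ((Ioo_infinite zero_lt_one).mono fun k hk => ?_)
      have h1 := hBA k hk
      rw [hB, eval_zero, zero_mul, eval_neg, neg_mul, eq_comm, neg_eq_zero] at h1
      exact (mul_eq_zero.1 h1).resolve_right (hEpos k (hIoo k hk)).ne'
end

section
/- Let q₁, q₂, q₃, q₄ be real polynomials in the four variables (x,y,z,p). If q₁(x,y,z,p)·R_F(x,y,z) + q₂(x,y,z,p)·R_D(x,y,z) + q₃(x,y,z,p)·R_J(x,y,z,p) + q₄(x,y,z,p)/√(xyz) = 0 for all x, y, z, p > 0, then q₁, q₂, q₃ and q₄ are all identically zero. (Equivalently, R_F, R_D, R_J and 1/√(xyz) are linearly independent over the field of rational functions of x, y, z, p.) -/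
open MeasureTheory

/-- Symmetric elliptic integral of the first kind. -/
noncomputable def RF (x y z : ℝ) : ℝ :=
  (1/2) * ∫ t in Set.Ioi (0:ℝ), 1 / Real.sqrt ((t + x) * (t + y) * (t + z))

/-- Symmetric elliptic integral of the second kind. -/
noncomputable def RD (x y z : ℝ) : ℝ :=
  (3/2) * ∫ t in Set.Ioi (0:ℝ), 1 / (Real.sqrt ((t + x) * (t + y)) * (t + z) ^ ((3:ℝ)/2))

/-- Symmetric elliptic integral of the third kind. -/
noncomputable def RJ (x y z p : ℝ) : ℝ :=
  (3/2) * ∫ t in Set.Ioi (0:ℝ), 1 / (Real.sqrt ((t + x) * (t + y) * (t + z)) * (t + p))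

open Filter Topology Set

theorem integrableOn_RF {x y z : ℝ} (hx : 0 ≤ x) (hy : 0 < y) (hz : 0 < z) :
    IntegrableOn (fun t => 1 / √((t + x) * (t + y) * (t + z))) (Ioi 0) := by
  have hmeas : Measurable fun t => 1 / √((t + x) * (t + y) * (t + z)) := by fun_prop
  rw [← Ioc_union_Ioi_eq_Ioi (zero_le_one (α := ℝ))]
  refine IntegrableOn.union ?_ ?_
  · have h : IntegrableOn (fun t : ℝ => 1 / √(y * z) * t ^ (-(1 / 2) : ℝ)) (Ioc 0 1) := by
      refine Integrable.const_mul ?_ _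
      have := (intervalIntegral.intervalIntegrable_rpow' (a := 0) (b := 1)
        (r := -(1 / 2)) (by norm_num))
      rwa [intervalIntegrable_iff_integrableOn_Ioc_of_le zero_le_one] at this
    refine Integrable.mono' h hmeas.aestronglyMeasurable
      (ae_restrict_of_forall_mem measurableSet_Ioc fun t ht => ?_)
    have ht0 : 0 < t := ht.1
    rw [Real.norm_of_nonneg (by positivity), Real.rpow_neg ht0.le, ← Real.sqrt_eq_rpow,
      ← one_div, one_div_mul_one_div, ← Real.sqrt_mul (by positivity)]
    refine one_div_le_one_div_of_le (by positivity) (Real.sqrt_le_sqrt ?_)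
    calc y * z * t = t * y * z := by ring
      _ ≤ (t + x) * (t + y) * (t + z) := by gcongr <;> linarith
  · refine Integrable.mono' (integrableOn_Ioi_rpow_of_lt (a := -(3 / 2)) (by norm_num) one_pos)
      hmeas.aestronglyMeasurable (ae_restrict_of_forall_mem measurableSet_Ioi fun t ht => ?_)
    have ht0 : 0 < t := one_pos.trans ht
    have e : t ^ (-(3 / 2) : ℝ) = 1 / √(t * t * t) := by
      rw [Real.rpow_neg ht0.le, ← one_div, Real.sqrt_eq_rpow, ← pow_two, ← pow_succ,
        ← Real.rpow_natCast, ← Real.rpow_mul ht0.le]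
      norm_num
    rw [Real.norm_of_nonneg (by positivity), e]
    gcongr <;> linarith

theorem rpow_three_halves {u : ℝ} (hu : 0 ≤ u) : u ^ (3 / 2 : ℝ) = √u * u := by
  rw [show (3 / 2 : ℝ) = 1 / 2 + 1 by norm_num, Real.rpow_add_one' hu (by norm_num),
    Real.sqrt_eq_rpow]

theorem RD_integrand_eq {x y z t : ℝ} (hx : 0 ≤ x) (hy : 0 < y) (hz : 0 < z) (ht : 0 < t) :
    1 / (√((t + x) * (t + y)) * (t + z) ^ (3 / 2 : ℝ)) =
      1 / (√((t + x) * (t + y) * (t + z)) * (t + z)) := by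
  rw [rpow_three_halves (by positivity), Real.sqrt_mul (by positivity) (t + z), mul_assoc]

theorem RD_eq_RJ {x y z : ℝ} (hx : 0 ≤ x) (hy : 0 < y) (hz : 0 < z) :
    RD x y z = RJ x y z z := by
  rw [RD, RJ, setIntegral_congr_fun measurableSet_Ioi fun t ht => RD_integrand_eq hx hy hz ht]

theorem integrableOn_RJ {x y z p : ℝ} (hx : 0 ≤ x) (hy : 0 < y) (hz : 0 < z) (hp : 0 < p) :
    IntegrableOn (fun t => 1 / (√((t + x) * (t + y) * (t + z)) * (t + p))) (Ioi 0) := by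
  have hmeas : Measurable fun t => 1 / (√((t + x) * (t + y) * (t + z)) * (t + p)) := by fun_prop
  refine Integrable.mono' ((integrableOn_RF hx hy hz).div_const p) hmeas.aestronglyMeasurable
    (ae_restrict_of_forall_mem measurableSet_Ioi fun t (ht : 0 < t) => ?_)
  rw [Real.norm_of_nonneg (by positivity), div_div]
  gcongr
  linarith

theorem tendsto_RF_zero {y z : ℝ} (hy : 0 < y) (hz : 0 < z) :
    Tendsto (fun x => RF x y z) (𝓝[>] 0) (𝓝 (RF 0 y z)) := by
  refine Tendsto.const_mul _ (tendsto_integral_filter_of_dominated_convergence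
    (fun t => 1 / √((t + 0) * (t + y) * (t + z))) ?_ ?_ (integrableOn_RF le_rfl hy hz) ?_)
  · exact Eventually.of_forall fun x => Measurable.aestronglyMeasurable (by fun_prop)
  · filter_upwards [self_mem_nhdsWithin] with x (hx : 0 < x)
    refine ae_restrict_of_forall_mem measurableSet_Ioi fun t (ht : 0 < t) => ?_
    rw [Real.norm_of_nonneg (by positivity)]
    gcongr
  · refine ae_restrict_of_forall_mem measurableSet_Ioi fun t (ht : 0 < t) => ?_
    refine tendsto_nhdsWithin_of_tendsto_nhds (ContinuousAt.tendsto ?_)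
    refine continuousAt_const.div (by fun_prop) (by positivity)

theorem tendsto_RD_zero {y z : ℝ} (hy : 0 < y) (hz : 0 < z) :
    Tendsto (fun x => RD x y z) (𝓝[>] 0) (𝓝 (RD 0 y z)) := by
  rw [RD_eq_RJ le_rfl hy hz]
  have : Tendsto (fun x => RJ x y z z) (𝓝[>] 0) (𝓝 (RJ 0 y z z)) := by
    refine Tendsto.const_mul _ (tendsto_integral_filter_of_dominated_convergence
      (fun t => 1 / (√((t + 0) * (t + y) * (t + z)) * (t + z))) ?_ ?_
      (integrableOn_RJ le_rfl hy hz hz) ?_)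
    · exact Eventually.of_forall fun x => Measurable.aestronglyMeasurable (by fun_prop)
    · filter_upwards [self_mem_nhdsWithin] with x (hx : 0 < x)
      refine ae_restrict_of_forall_mem measurableSet_Ioi fun t (ht : 0 < t) => ?_
      rw [Real.norm_of_nonneg (by positivity)]
      gcongr
    · refine ae_restrict_of_forall_mem measurableSet_Ioi fun t (ht : 0 < t) => ?_
      refine tendsto_nhdsWithin_of_tendsto_nhds (ContinuousAt.tendsto ?_)
      refine continuousAt_const.div (by fun_prop) (by positivity)
  refine this.congr' ?_
  filter_upwards [self_mem_nhdsWithin] with x (hx : 0 < x)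
  rw [RD_eq_RJ hx.le hy hz]

/-- Integrals over `(0, ∞)` of nonnegative functions bounded below by `c / t` on `(s, 1]` diverge
as `s → 0⁺`. -/
theorem tendsto_integral_atTop_of_div_le {f : ℝ → ℝ → ℝ} {c : ℝ} (hc : 0 < c)
    (hint : ∀ s, 0 < s → IntegrableOn (f s) (Ioi 0))
    (hnonneg : ∀ s t, 0 < s → 0 < t → 0 ≤ f s t)
    (hle : ∀ s t, 0 < s → s < t → t ≤ 1 → c / t ≤ f s t) :
    Tendsto (fun s => ∫ t in Ioi 0, f s t) (𝓝[>] 0) atTop := by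
  have hlog : Tendsto (fun s => c * -Real.log s) (𝓝[>] 0) atTop :=
    (tendsto_neg_atBot_atTop.comp Real.tendsto_log_nhdsGT_zero).const_mul_atTop hc
  refine tendsto_atTop_mono' _ ?_ hlog
  filter_upwards [Ioo_mem_nhdsGT one_pos] with s ⟨hs, hs1⟩
  have hsub : Ioc s 1 ⊆ Ioi 0 := fun t ht => hs.trans ht.1
  have hnot : (0 : ℝ) ∉ uIcc s 1 := by
    rw [uIcc_of_le hs1.le]; exact fun h => hs.not_ge h.1
  calc c * -Real.log s = ∫ t in Ioc s 1, c / t := by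
        rw [← intervalIntegral.integral_of_le hs1.le]
        simp_rw [div_eq_mul_inv]
        rw [intervalIntegral.integral_const_mul, integral_inv hnot, one_div, Real.log_inv]
    _ ≤ ∫ t in Ioc s 1, f s t := by
        refine setIntegral_mono_on ?_ ((hint s hs).mono_set hsub) measurableSet_Ioc
          fun t ht => hle s t hs ht.1 ht.2
        rw [← intervalIntegrable_iff_integrableOn_Ioc_of_le hs1.le]
        exact (intervalIntegrable_inv_iff.2 (Or.inr hnot)).const_mul c
    _ ≤ ∫ t in Ioi 0, f s t :=
        setIntegral_mono_set (hint s hs)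
          (ae_restrict_of_forall_mem measurableSet_Ioi fun t ht => hnonneg s t hs ht)
          hsub.eventuallyLE

theorem tendsto_RF_atTop {y : ℝ} (hy : 0 < y) :
    Tendsto (fun z => RF 0 y z) (𝓝[>] 0) atTop := by
  refine Tendsto.const_mul_atTop (by norm_num) (tendsto_integral_atTop_of_div_le
    (c := 1 / √(2 * (1 + y))) (by positivity) (fun z hz => integrableOn_RF le_rfl hy hz)
    (fun z t hz ht => by positivity) fun z t hz hzt ht => ?_)
  have ht0 : 0 < t := hz.trans hzt
  have e : √(2 * (1 + y)) * t = √(2 * (1 + y) * t ^ 2) := by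
    rw [Real.sqrt_mul (by positivity) (t ^ 2), Real.sqrt_sq ht0.le]
  rw [div_div, e]
  refine one_div_le_one_div_of_le (by positivity) (Real.sqrt_le_sqrt ?_)
  calc (t + 0) * (t + y) * (t + z) ≤ t * (1 + y) * (t + t) := by
        rw [add_zero]; gcongr
    _ = 2 * (1 + y) * t ^ 2 := by ring

theorem tendsto_RJ_atTop {x y z : ℝ} (hx : 0 < x) (hy : 0 < y) (hz : 0 < z) :
    Tendsto (fun p => RJ x y z p) (𝓝[>] 0) atTop := by
  refine Tendsto.const_mul_atTop (by norm_num) (tendsto_integral_atTop_of_div_le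
    (c := 1 / (√((1 + x) * (1 + y) * (1 + z)) * 2)) (by positivity)
    (fun p hp => integrableOn_RJ hx.le hy hz hp)
    (fun p t hp ht => by positivity) fun p t hp hpt ht => ?_)
  have ht0 : 0 < t := hp.trans hpt
  rw [div_div, mul_assoc]
  gcongr
  linarith

theorem tendsto_mul_RF_zero {y : ℝ} (hy : 0 < y) :
    Tendsto (fun z => z * RF 0 y z) (𝓝[>] 0) (𝓝 0) := by
  have h : Tendsto (fun z => √z * RF 0 y 1) (𝓝[>] 0) (𝓝 0) := by
    refine tendsto_nhdsWithin_of_tendsto_nhds ?_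
    have : Continuous fun z => √z * RF 0 y 1 := by fun_prop
    simpa using this.tendsto 0
  refine squeeze_zero' ?_ ?_ h
  · filter_upwards [self_mem_nhdsWithin] with z (hz : 0 < z)
    have : 0 ≤ ∫ t in Ioi (0 : ℝ), 1 / √((t + 0) * (t + y) * (t + z)) :=
      integral_nonneg fun t => by positivity
    unfold RF
    positivity
  · filter_upwards [Ioo_mem_nhdsGT one_pos] with z ⟨hz, hz1⟩
    unfold RF
    rw [mul_left_comm, mul_left_comm √z, ← integral_const_mul z, ← integral_const_mul √z]
    refine mul_le_mul_of_nonneg_left (a := 1 / 2) (setIntegral_mono_on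
      ((integrableOn_RF le_rfl hy hz).const_mul _)
      ((integrableOn_RF le_rfl hy one_pos).const_mul _) measurableSet_Ioi
      fun t (ht : 0 < t) => ?_) (by norm_num)
    nth_rw 1 [← Real.mul_self_sqrt hz.le]
    rw [mul_assoc, mul_one_div]
    refine mul_le_mul_of_nonneg_left ?_ (by positivity)
    rw [div_le_div_iff₀ (by positivity) (by positivity), ← Real.sqrt_mul hz.le, one_mul]
    refine Real.sqrt_le_sqrt ?_
    rw [mul_left_comm]
    gcongr
    nlinarith

theorem tendsto_mul_RJ_zero {x y z : ℝ} (hx : 0 < x) (hy : 0 < y) (hz : 0 < z) :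
    Tendsto (fun p => p * RJ x y z p) (𝓝[>] 0) (𝓝 0) := by
  have h : Tendsto (fun p => ∫ t in Ioi 0, p * (1 / (√((t + x) * (t + y) * (t + z)) * (t + p))))
      (𝓝[>] 0) (𝓝 (∫ t in Ioi (0 : ℝ), (0 : ℝ))) := by
    refine tendsto_integral_filter_of_dominated_convergence
      (fun t => 1 / √((t + x) * (t + y) * (t + z))) ?_ ?_ (integrableOn_RF hx.le hy hz) ?_
    · exact Eventually.of_forall fun x => Measurable.aestronglyMeasurable (by fun_prop)
    · filter_upwards [self_mem_nhdsWithin] with p (hp : 0 < p)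
      refine ae_restrict_of_forall_mem measurableSet_Ioi fun t (ht : 0 < t) => ?_
      rw [Real.norm_of_nonneg (by positivity), mul_one_div,
        div_le_div_iff₀ (by positivity) (by positivity), mul_comm, one_mul]
      gcongr
      linarith
    · refine ae_restrict_of_forall_mem measurableSet_Ioi fun t (ht : 0 < t) => ?_
      refine tendsto_nhdsWithin_of_tendsto_nhds ?_
      have : ContinuousAt
          (fun p => p * (1 / (√((t + x) * (t + y) * (t + z)) * (t + p)))) 0 :=
        continuousAt_id.mul (continuousAt_const.div (by fun_prop) (by positivity))
      simpa using this.tendsto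
  simp_rw [integral_const_mul] at h
  simpa [RJ, mul_left_comm] using h.const_mul (3 / 2)

theorem mul_RD_eq {y z : ℝ} (hy : 0 < y) (hz : 0 < z) :
    z * RD 0 y z = 3 / 2 * ∫ t in Ioi (0 : ℝ), 1 / (√(t * (z * t + y) * (t + 1)) * (t + 1)) := by
  have hs := integral_comp_mul_left_Ioi
    (fun t : ℝ => 1 / (√((t + 0) * (t + y) * (t + z)) * (t + z))) 0 hz
  rw [mul_zero, smul_eq_mul, eq_inv_mul_iff_mul_eq₀ hz.ne'] at hs
  rw [RD_eq_RJ le_rfl hy hz, RJ, mul_left_comm, ← hs, ← integral_const_mul, ← integral_const_mul]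
  congr 1
  refine setIntegral_congr_fun (E := ℝ) measurableSet_Ioi fun t (ht : 0 < t) => ?_
  have e : (z * t + 0) * (z * t + y) * (z * t + z) = z ^ 2 * (t * (z * t + y) * (t + 1)) := by ring
  simp only [e]
  rw [Real.sqrt_mul (by positivity), Real.sqrt_sq hz.le]
  field_simp

/-- `z * RD 0 y z` stays between two positive constants as `z → 0⁺`. -/
theorem mul_RD_bounds {y : ℝ} (hy : 0 < y) : ∃ c C : ℝ, 0 < c ∧
    ∀ᶠ z in 𝓝[>] 0, c ≤ z * RD 0 y z ∧ z * RD 0 y z ≤ C := by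
  have hU : IntegrableOn (fun t => 1 / √y * (1 / √((t + 0) * (t + 1) * (t + 1)))) (Ioi 0) :=
    (integrableOn_RF le_rfl one_pos one_pos).const_mul _
  have hle : ∀ z t : ℝ, 0 < z → 0 < t → 1 / (√(t * (z * t + y) * (t + 1)) * (t + 1)) ≤
      1 / √y * (1 / √((t + 0) * (t + 1) * (t + 1))) := fun z t hz ht => by
    rw [one_div_mul_one_div, ← Real.sqrt_mul hy.le]
    refine one_div_le_one_div_of_le (by positivity) ?_
    calc √(y * ((t + 0) * (t + 1) * (t + 1))) = √(t * y * (t + 1)) * √(t + 1) := by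
          rw [← Real.sqrt_mul (by positivity)]; ring_nf
      _ ≤ √(t * (z * t + y) * (t + 1)) * (t + 1) := by
          gcongr
          · nlinarith [mul_pos hz ht]
          · exact Real.sqrt_le_iff.2 ⟨by positivity, by nlinarith⟩
  have hint : ∀ z : ℝ, 0 < z →
      IntegrableOn (fun t => 1 / (√(t * (z * t + y) * (t + 1)) * (t + 1))) (Ioi 0) :=
    fun z hz => Integrable.mono' hU (Measurable.aestronglyMeasurable (by fun_prop))
      (ae_restrict_of_forall_mem measurableSet_Ioi fun t (ht : 0 < t) => by
        rw [Real.norm_of_nonneg (by positivity)]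
        exact hle z t hz ht)
  refine ⟨3 / 2 * ∫ t in Ioi (0 : ℝ), 1 / (√(t * (1 * t + y) * (t + 1)) * (t + 1)),
    3 / 2 * ∫ t in Ioi (0 : ℝ), 1 / √y * (1 / √((t + 0) * (t + 1) * (t + 1))), ?_, ?_⟩
  · refine mul_pos (by norm_num) ((setIntegral_pos_iff_support_of_nonneg_ae
      (ae_restrict_of_forall_mem measurableSet_Ioi fun t (ht : 0 < t) => ?_)
      (hint 1 one_pos)).2 ?_)
    · simp only [Pi.zero_apply]
      positivity
    · refine lt_of_lt_of_le (b := volume (Ioi (0 : ℝ))) (by simp)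
        (measure_mono fun t (ht : 0 < t) => ⟨?_, ht⟩)
      rw [Function.mem_support]
      positivity
  · filter_upwards [Ioo_mem_nhdsGT one_pos] with z ⟨hz, hz1⟩
    rw [mul_RD_eq hy hz]
    constructor
    · refine mul_le_mul_of_nonneg_left (setIntegral_mono_on (hint 1 one_pos) (hint z hz)
        measurableSet_Ioi fun t (ht : 0 < t) => ?_) (by norm_num)
      gcongr
    · exact mul_le_mul_of_nonneg_left (setIntegral_mono_on (hint z hz) hU measurableSet_Ioi
        fun t ht => hle z t hz ht) (by norm_num)

namespace Polynomial

theorem tendsto_eval_nhdsGT_zero (P : ℝ[X]) :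
    Tendsto (fun x => P.eval x) (𝓝[>] 0) (𝓝 (P.coeff 0)) := by
  rw [coeff_zero_eq_eval_zero]
  exact tendsto_nhdsWithin_of_tendsto_nhds P.continuous.continuousAt

theorem eval_eq_mul_eval_divX {R : Type*} [CommSemiring R] {P : R[X]} (h : P.coeff 0 = 0) (x : R) :
    P.eval x = x * P.divX.eval x := by
  conv_lhs => rw [← X_mul_divX_add P]
  simp [h]

/-- A function that tends to infinity more slowly than `1 / x` at `0⁺` is linearly independent, over
polynomials, of any function bounded between positive constants. -/
theorem eq_zero_of_eval_mul_add_eval_mul_eq_zero {F G : ℝ → ℝ} {c C : ℝ}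
    (hF : Tendsto F (𝓝[>] 0) atTop) (hxF : Tendsto (fun x => x * F x) (𝓝[>] 0) (𝓝 0))
    (hc : 0 < c) (hG : ∀ᶠ x in 𝓝[>] 0, c ≤ G x ∧ G x ≤ C) {A B : ℝ[X]}
    (h : ∀ x, 0 < x → A.eval x * F x + B.eval x * G x = 0) : A = 0 ∧ B = 0 := by
  have hzero : ∀ A B : ℝ[X], (∀ x, 0 < x → A.eval x * F x + B.eval x * G x = 0) →
      A.coeff 0 = 0 ∧ B.coeff 0 = 0 := by
    intro A B h
    have hGb : IsBoundedUnder (· ≤ ·) (𝓝[>] 0) (norm ∘ G) :=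
      ⟨C, by
        rw [eventually_map]
        filter_upwards [hG] with x hx
        rw [Function.comp_apply, Real.norm_of_nonneg (hc.le.trans hx.1)]
        exact hx.2⟩
    have hGF : Tendsto (fun x => (F x)⁻¹ * G x) (𝓝[>] 0) (𝓝 0) :=
      hF.inv_tendsto_atTop.zero_mul_isBoundedUnder_le hGb
    have hA : A.coeff 0 = 0 := by
      have h1 : Tendsto (fun x => -(B.eval x * ((F x)⁻¹ * G x))) (𝓝[>] 0) (𝓝 0) := by
        simpa using (B.tendsto_eval_nhdsGT_zero.mul hGF).neg
      refine tendsto_nhds_unique (A.tendsto_eval_nhdsGT_zero.congr' ?_) h1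
      filter_upwards [self_mem_nhdsWithin, hF.eventually_gt_atTop 0] with x hx hFx
      have := h x hx
      field_simp
      linarith
    refine ⟨hA, ?_⟩
    have h2 : Tendsto (fun x => A.divX.eval x * (x * F x)) (𝓝[>] 0) (𝓝 0) := by
      simpa using A.divX.tendsto_eval_nhdsGT_zero.mul hxF
    have hGinv : IsBoundedUnder (· ≤ ·) (𝓝[>] 0) (norm ∘ fun x => (G x)⁻¹) :=
      ⟨c⁻¹, by
        rw [eventually_map]
        filter_upwards [hG] with x hx
        have := hc.trans_le hx.1
        rw [Function.comp_apply, Real.norm_of_nonneg (by positivity)]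
        exact inv_anti₀ hc hx.1⟩
    have h3 : Tendsto (fun x => -(A.divX.eval x * (x * F x) * (G x)⁻¹)) (𝓝[>] 0) (𝓝 0) := by
      simpa using (h2.zero_mul_isBoundedUnder_le hGinv).neg
    refine tendsto_nhds_unique (B.tendsto_eval_nhdsGT_zero.congr' ?_) h3
    filter_upwards [self_mem_nhdsWithin, hG] with x hx hGx
    have hGx0 := hc.trans_le hGx.1
    have := h x hx
    rw [eval_eq_mul_eval_divX hA] at this
    field_simp
    linarith
  have hcoeff : ∀ (n : ℕ) (A B : ℝ[X]),
      (∀ x, 0 < x → A.eval x * F x + B.eval x * G x = 0) → A.coeff n = 0 ∧ B.coeff n = 0 := by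
    intro n
    induction n with
    | zero => exact hzero
    | succ n ih =>
      intro A B h
      obtain ⟨hA, hB⟩ := hzero A B h
      simp_rw [← coeff_divX]
      refine ih _ _ fun x hx => ?_
      have := h x hx
      rw [eval_eq_mul_eval_divX hA, eval_eq_mul_eval_divX hB, mul_assoc, mul_assoc,
        ← mul_add] at this
      exact (mul_eq_zero.1 this).resolve_left hx.ne'
  exact ⟨ext fun n => (hcoeff n A B h).1, ext fun n => (hcoeff n A B h).2⟩

end Polynomial

open Polynomial in
/-- The constant terms in `x` of a relation between `RF`, `RD` and `1 / √(x * y * z)`. -/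
theorem coeff_zero_of_relation {y z : ℝ} (hy : 0 < y) (hz : 0 < z) {A B D : ℝ[X]}
    (h : ∀ x, 0 < x → A.eval x * RF x y z + B.eval x * RD x y z + D.eval x / √(x * y * z) = 0) :
    D.coeff 0 = 0 ∧ A.coeff 0 * RF 0 y z + B.coeff 0 * RD 0 y z = 0 := by
  have hlim : Tendsto (fun x => A.eval x * RF x y z + B.eval x * RD x y z) (𝓝[>] 0)
      (𝓝 (A.coeff 0 * RF 0 y z + B.coeff 0 * RD 0 y z)) :=
    (A.tendsto_eval_nhdsGT_zero.mul (tendsto_RF_zero hy hz)).add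
      (B.tendsto_eval_nhdsGT_zero.mul (tendsto_RD_zero hy hz))
  have hsqrt : Tendsto (fun x => √(x * y * z)) (𝓝[>] 0) (𝓝 0) := by
    refine tendsto_nhdsWithin_of_tendsto_nhds ?_
    have : Continuous fun x => √(x * y * z) := by fun_prop
    simpa using this.tendsto 0
  have hD : D.coeff 0 = 0 := by
    have h1 : Tendsto (fun x => -((A.eval x * RF x y z + B.eval x * RD x y z) * √(x * y * z)))
        (𝓝[>] 0) (𝓝 0) := by simpa using (hlim.mul hsqrt).neg
    refine tendsto_nhds_unique (D.tendsto_eval_nhdsGT_zero.congr' ?_) h1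
    filter_upwards [self_mem_nhdsWithin] with x (hx : 0 < x)
    have hs : 0 < √(x * y * z) := by positivity
    rw [eq_neg_of_add_eq_zero_left (h x hx)]
    field_simp
  refine ⟨hD, ?_⟩
  have h2 : Tendsto (fun x => -(D.divX.eval x * √(x * y * z) / (y * z))) (𝓝[>] 0) (𝓝 0) := by
    simpa using ((D.divX.tendsto_eval_nhdsGT_zero.mul hsqrt).div_const (y * z)).neg
  refine tendsto_nhds_unique (hlim.congr' ?_) h2
  filter_upwards [self_mem_nhdsWithin] with x (hx : 0 < x)
  have hs : 0 < √(x * y * z) := by positivity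
  have hsq : √(x * y * z) ^ 2 = x * y * z := Real.sq_sqrt (by positivity)
  rw [eq_neg_of_add_eq_zero_left (h x hx), eval_eq_mul_eval_divX hD]
  field_simp
  rw [hsq]
  ring

namespace MvPolynomial

theorem eq_zero_of_eval_pos {n : ℕ} {q : MvPolynomial (Fin n) ℝ}
    (h : ∀ v : Fin n → ℝ, (∀ i, 0 < v i) → eval v q = 0) : q = 0 :=
  funext_set (fun _ => Ioi 0) (fun _ => Ioi_infinite 0) fun v hv => by
    rw [h v fun i => hv i (mem_univ i), map_zero]

theorem eval_aeval_polynomial {σ : Type*} (v : σ → Polynomial ℝ) (q : MvPolynomial σ ℝ) (s : ℝ) :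
    (aeval v q).eval s = eval (fun i => (v i).eval s) q := by
  induction q using MvPolynomial.induction_on with
  | C a => simp
  | add p q hp hq => simp [hp, hq]
  | mul_X p i hp => simp [hp]

end MvPolynomial

open MvPolynomial in
theorem complete_integrals_linear_independent {a b : MvPolynomial (Fin 3) ℝ}
    (h : ∀ y z p : ℝ, 0 < y → 0 < z → 0 < p →
      eval ![y, z, p] a * RF 0 y z + eval ![y, z, p] b * RD 0 y z = 0) : a = 0 ∧ b = 0 := by
  have key : ∀ v : Fin 3 → ℝ, (∀ i, 0 < v i) → eval v a = 0 ∧ eval v b = 0 := by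
    intro v hv
    let w : Fin 3 → Polynomial ℝ := ![.C (v 0), .X, .C (v 2)]
    have hw : ∀ (q : MvPolynomial (Fin 3) ℝ) (s : ℝ),
        (aeval w q).eval s = eval ![v 0, s, v 2] q := fun q s => by
      rw [eval_aeval_polynomial]
      congr 2
      ext i
      fin_cases i <;> simp [w]
    have hv' : ![v 0, v 1, v 2] = v := by ext i; fin_cases i <;> rfl
    obtain ⟨c, C, hc, hG⟩ := mul_RD_bounds (hv 0)
    obtain ⟨hA, hB⟩ := Polynomial.eq_zero_of_eval_mul_add_eval_mul_eq_zero
      (tendsto_RF_atTop (hv 0)) (tendsto_mul_RF_zero (hv 0)) hc hG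
      (A := .X * aeval w a) (B := aeval w b) fun z hz => by
        rw [Polynomial.eval_mul, Polynomial.eval_X, hw, hw]
        linear_combination z * h (v 0) z (v 2) (hv 0) hz (hv 2)
    constructor
    · rw [← hv', ← hw, (mul_eq_zero.1 hA).resolve_left Polynomial.X_ne_zero, Polynomial.eval_zero]
    · rw [← hv', ← hw, hB, Polynomial.eval_zero]
  exact ⟨eq_zero_of_eval_pos fun v hv => (key v hv).1, eq_zero_of_eval_pos fun v hv => (key v hv).2⟩

open MvPolynomial in
/-- Linear independence of `RF`, `RD` and `1 / √(x * y * z)`, with the coefficients written as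
polynomials in `x` over the polynomials in the remaining variables. -/
theorem RF_RD_linear_independent {A B D : Polynomial (MvPolynomial (Fin 3) ℝ)}
    (h : ∀ x y z p : ℝ, 0 < x → 0 < y → 0 < z → 0 < p →
      (A.map (eval ![y, z, p])).eval x * RF x y z + (B.map (eval ![y, z, p])).eval x * RD x y z
        + (D.map (eval ![y, z, p])).eval x / √(x * y * z) = 0) :
    A = 0 ∧ B = 0 ∧ D = 0 := by
  have hzero : ∀ A B D : Polynomial (MvPolynomial (Fin 3) ℝ),
      (∀ x y z p : ℝ, 0 < x → 0 < y → 0 < z → 0 < p →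
        (A.map (eval ![y, z, p])).eval x * RF x y z + (B.map (eval ![y, z, p])).eval x * RD x y z
          + (D.map (eval ![y, z, p])).eval x / √(x * y * z) = 0) →
      A.coeff 0 = 0 ∧ B.coeff 0 = 0 ∧ D.coeff 0 = 0 := by
    intro A B D h
    have hrel := fun y z p (hy : 0 < y) (hz : 0 < z) (hp : 0 < p) =>
      coeff_zero_of_relation hy hz fun x hx => h x y z p hx hy hz hp
    simp only [Polynomial.coeff_map] at hrel
    obtain ⟨hA, hB⟩ := complete_integrals_linear_independent fun y z p hy hz hp =>
      (hrel y z p hy hz hp).2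
    refine ⟨hA, hB, eq_zero_of_eval_pos fun v hv => ?_⟩
    have hv' : ![v 0, v 1, v 2] = v := by ext i; fin_cases i <;> rfl
    rw [← hv']
    exact (hrel _ _ _ (hv 0) (hv 1) (hv 2)).1
  have hcoeff : ∀ (n : ℕ) (A B D : Polynomial (MvPolynomial (Fin 3) ℝ)),
      (∀ x y z p : ℝ, 0 < x → 0 < y → 0 < z → 0 < p →
        (A.map (eval ![y, z, p])).eval x * RF x y z + (B.map (eval ![y, z, p])).eval x * RD x y z
          + (D.map (eval ![y, z, p])).eval x / √(x * y * z) = 0) →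
      A.coeff n = 0 ∧ B.coeff n = 0 ∧ D.coeff n = 0 := by
    intro n
    induction n with
    | zero => exact hzero
    | succ n ih =>
      intro A B D h
      obtain ⟨hA, hB, hD⟩ := hzero A B D h
      simp_rw [← Polynomial.coeff_divX]
      refine ih _ _ _ fun x y z p hx hy hz hp => ?_
      have hdiv : ∀ Q : Polynomial (MvPolynomial (Fin 3) ℝ), Q.coeff 0 = 0 →
          (Q.map (eval ![y, z, p])).eval x = x * (Q.divX.map (eval ![y, z, p])).eval x := by
        intro Q hQ
        conv_lhs => rw [← Polynomial.X_mul_divX_add Q]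
        simp [hQ]
      have := h x y z p hx hy hz hp
      rw [hdiv A hA, hdiv B hB, hdiv D hD, mul_assoc, mul_assoc, mul_div_assoc, ← mul_add,
        ← mul_add] at this
      exact (mul_eq_zero.1 this).resolve_left hx.ne'
  exact ⟨Polynomial.ext fun n => (hcoeff n A B D h).1,
    Polynomial.ext fun n => (hcoeff n A B D h).2.1, Polynomial.ext fun n => (hcoeff n A B D h).2.2⟩

open MvPolynomial in
/-- The coefficient of `RJ` vanishes, because of the logarithmic singularity as `p → 0⁺`. -/
theorem coeff_RJ_eq_zero {q₁ q₂ q₃ q₄ : MvPolynomial (Fin 4) ℝ}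
    (h : ∀ x y z p : ℝ, 0 < x → 0 < y → 0 < z → 0 < p →
      eval ![x, y, z, p] q₁ * RF x y z + eval ![x, y, z, p] q₂ * RD x y z
        + eval ![x, y, z, p] q₃ * RJ x y z p + eval ![x, y, z, p] q₄ / √(x * y * z) = 0) :
    q₃ = 0 := by
  refine eq_zero_of_eval_pos fun v hv => ?_
  let w : Fin 4 → Polynomial ℝ := ![.C (v 0), .C (v 1), .C (v 2), .X]
  have hw : ∀ (q : MvPolynomial (Fin 4) ℝ) (s : ℝ),
      (aeval w q).eval s = eval ![v 0, v 1, v 2, s] q := fun q s => by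
    rw [eval_aeval_polynomial]
    congr 2
    ext i
    fin_cases i <;> simp [w]
  have hv' : ![v 0, v 1, v 2, v 3] = v := by ext i; fin_cases i <;> rfl
  have hA := (Polynomial.eq_zero_of_eval_mul_add_eval_mul_eq_zero
    (tendsto_RJ_atTop (hv 0) (hv 1) (hv 2)) (tendsto_mul_RJ_zero (hv 0) (hv 1) (hv 2)) one_pos
    (G := fun _ => 1) (Eventually.of_forall fun _ => ⟨le_rfl, le_rfl⟩)
    (A := aeval w q₃)
    (B := aeval w q₁ * .C (RF (v 0) (v 1) (v 2)) + aeval w q₂ * .C (RD (v 0) (v 1) (v 2))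
      + aeval w q₄ * .C (1 / √(v 0 * v 1 * v 2))) fun p hp => by
      simp only [Polynomial.eval_add, Polynomial.eval_mul, Polynomial.eval_C, hw]
      linear_combination h (v 0) (v 1) (v 2) p (hv 0) (hv 1) (hv 2) hp).1
  rw [← hv', ← hw, hA, Polynomial.eval_zero]

/-- linear independence of `R_F`, `R_D`, `R_J` and `1/√(xyz)` over polynomial
(equivalently, rational function) coefficients in `(x,y,z,p)`. -/
theorem symmetric_integrals_linear_independent
    (q₁ q₂ q₃ q₄ : MvPolynomial (Fin 4) ℝ)
    (h : ∀ x y z p : ℝ, 0 < x → 0 < y → 0 < z → 0 < p →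
      MvPolynomial.eval ![x, y, z, p] q₁ * RF x y z
        + MvPolynomial.eval ![x, y, z, p] q₂ * RD x y z
        + MvPolynomial.eval ![x, y, z, p] q₃ * RJ x y z p
        + MvPolynomial.eval ![x, y, z, p] q₄ / Real.sqrt (x * y * z) = 0) :
    q₁ = 0 ∧ q₂ = 0 ∧ q₃ = 0 ∧ q₄ = 0 := by
  obtain rfl := coeff_RJ_eq_zero h
  have hcons : ∀ (q : MvPolynomial (Fin 4) ℝ) (x y z p : ℝ), MvPolynomial.eval ![x, y, z, p] q =
      ((MvPolynomial.finSuccEquiv ℝ 3 q).map (MvPolynomial.eval ![y, z, p])).eval x :=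
    fun q x y z p => MvPolynomial.eval_eq_eval_mv_eval' ![y, z, p] x q
  obtain ⟨h₁, h₂, h₄⟩ := RF_RD_linear_independent fun x y z p hx hy hz hp => by
    have := h x y z p hx hy hz hp
    rwa [map_zero, zero_mul, add_zero, hcons q₁, hcons q₂, hcons q₄] at this
  simp only [EmbeddingLike.map_eq_zero_iff] at h₁ h₂ h₄
  exact ⟨h₁, h₂, rfl, h₄⟩
end

section
/- Let p, q, r, μ be differentiable real functions on (−1,1) with μ(k) ∈ (0,1) and μ(k) ≠ k² for all k ∈ (−1,1), and let X be a differentiable positive function on (−1,1) satisfying X′(k) = [ k/(k²−μ(k)) + (μ(k)²−k²)μ′(k)/(2μ(k)(1−μ(k))(k²−μ(k))) ]·X(k). Set I(k) = p(k)K(k) + q(k)E(k) + r(k)Π(μ(k),k), a₃₁(k) = −μ′(k)/(2μ(k)(1−μ(k))), a₃₂(k) = k/((μ(k)−k²)(k²−1)) + μ′(k)/(2(1−μ(k))(μ(k)−k²)). Then for every k ∈ (−1,1) with k ≠ 0 and r(k) ≠ 0, r(k)²·d/dk( I(k)X(k)/r(k) ) = M(k)K(k) + N(k)E(k), where M(k)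 = (p′(k)r(k)−p(k)r′(k))X(k) + p(k)r(k)X′(k) − (p(k)+q(k))r(k)X(k)/k + a₃₁(k)r(k)²X(k) and N(k) = (q′(k)r(k)−q(k)r′(k))X(k) + q(k)r(k)X′(k) + p(k)r(k)X(k)/(k(1−k²)) + q(k)r(k)X(k)/k + a₃₂(k)r(k)²X(k). -/
/-- Complete elliptic integral of the third kind. -/
noncomputable def Pic (μ k : ℝ) : ℝ :=
  ∫ z in (0:ℝ)..1, 1 / ((1 - μ * z ^ 2) * Real.sqrt ((1 - z ^ 2) * (1 - k ^ 2 * z ^ 2)))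

open Real Set Filter Topology MeasureTheory intervalIntegral

/-- Leibniz rule: an integral whose integrand is continuously differentiable in its parameter
can be differentiated under the integral sign. -/
lemma hasFDerivAt_intervalIntegral_of_continuousOn {H : Type*} [NormedAddCommGroup H]
    [NormedSpace ℝ H] [ProperSpace H] {U : Set H} (hU : IsOpen U) {a b : ℝ} {F : H → ℝ → ℝ}
    {F' : H → ℝ → H →L[ℝ] ℝ} (hF : ContinuousOn (Function.uncurry F) (U ×ˢ univ))
    (hF' : ContinuousOn (Function.uncurry F') (U ×ˢ univ))
    (hd : ∀ x ∈ U, ∀ t, HasFDerivAt (fun x => F x t) (F' x t) x) {x₀ : H} (hx₀ : x₀ ∈ U) :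
    HasFDerivAt (fun x => ∫ t in a..b, F x t) (∫ t in a..b, F' x₀ t) x₀ := by
  have hFx {x : H} (hx : x ∈ U) : Continuous (F x) :=
    hF.comp_continuous (f := fun t => (x, t)) (by fun_prop) (fun t => ⟨hx, mem_univ t⟩)
  have hF'x : Continuous (F' x₀) :=
    hF'.comp_continuous (f := fun t => (x₀, t)) (by fun_prop) (fun t => ⟨hx₀, mem_univ t⟩)
  obtain ⟨ε, hε, hball⟩ := Metric.nhds_basis_closedBall.mem_iff.1 (hU.mem_nhds hx₀)
  obtain ⟨C, hC⟩ := ((isCompact_closedBall x₀ ε).prod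
    (isCompact_uIcc (a := a) (b := b))).exists_bound_of_continuousOn
    (hF'.mono (prod_mono hball (subset_univ _)))
  refine hasFDerivAt_integral_of_dominated_of_fderiv_le (bound := fun _ => C)
    (Metric.closedBall_mem_nhds x₀ hε) ?_ ((hFx hx₀).intervalIntegrable _ _)
    hF'x.aestronglyMeasurable ?_ intervalIntegrable_const ?_
  · filter_upwards [hU.mem_nhds hx₀] with x hx
    exact (hFx hx).aestronglyMeasurable
  · exact ae_of_all _ fun t ht x hx => hC (x, t) ⟨hx, uIoc_subset_uIcc ht⟩
  · exact ae_of_all _ fun t _ x hx => hd x (hball hx) t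

/-- Leibniz rule along a differentiable curve of the form `(n k, k)`. -/
lemma hasDerivAt_intervalIntegral_curve {U : Set (ℝ × ℝ)} (hU : IsOpen U) {a b : ℝ}
    {f f₁ f₂ : ℝ × ℝ → ℝ → ℝ} (hf : ContinuousOn (Function.uncurry f) (U ×ˢ univ))
    (hf₁ : ContinuousOn (Function.uncurry f₁) (U ×ˢ univ))
    (hf₂ : ContinuousOn (Function.uncurry f₂) (U ×ˢ univ))
    (hd : ∀ x ∈ U, ∀ t, HasFDerivAt (fun x => f x t)
      (f₁ x t • ContinuousLinearMap.fst ℝ ℝ ℝ + f₂ x t • ContinuousLinearMap.snd ℝ ℝ ℝ) x)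
    {n : ℝ → ℝ} {n' k : ℝ} (hn : HasDerivAt n n' k) (hk : (n k, k) ∈ U) :
    HasDerivAt (fun k => ∫ t in a..b, f (n k, k) t)
      (∫ t in a..b, (f₁ (n k, k) t * n' + f₂ (n k, k) t)) k := by
  have hF' : ContinuousOn (Function.uncurry fun x t => f₁ x t • ContinuousLinearMap.fst ℝ ℝ ℝ
      + f₂ x t • ContinuousLinearMap.snd ℝ ℝ ℝ) (U ×ˢ univ) :=
    (hf₁.smul continuousOn_const).add (hf₂.smul continuousOn_const)
  have key := (hasFDerivAt_intervalIntegral_of_continuousOn hU (a := a) (b := b) hf hF' hd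
    hk).comp_hasDerivAt (f := fun k => (n k, k)) k (hn.prodMk (hasDerivAt_id k))
  refine key.congr_deriv ?_
  have hcont : Continuous fun t => f₁ (n k, k) t • ContinuousLinearMap.fst ℝ ℝ ℝ
      + f₂ (n k, k) t • ContinuousLinearMap.snd ℝ ℝ ℝ :=
    hF'.comp_continuous (f := fun t : ℝ => ((n k, k), t)) (by fun_prop)
      (fun t => ⟨hk, mem_univ t⟩)
  rw [ContinuousLinearMap.intervalIntegral_apply (hcont.intervalIntegrable _ _)]
  simp

/-- The substitution `z = sin t`. -/
lemma integral_zero_one_eq_integral_sin (g : ℝ → ℝ) :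
    ∫ z in (0:ℝ)..1, g z = ∫ t in (0:ℝ)..(π / 2), cos t * g (sin t) := by
  have himage : sin '' Ioo 0 (π / 2) = Ioo 0 1 := by
    ext z
    constructor
    · rintro ⟨t, ⟨h0, h1⟩, rfl⟩
      refine ⟨sin_pos_of_pos_of_lt_pi h0 (by linarith), ?_⟩
      have := sin_lt_sin_of_lt_of_le_pi_div_two (by linarith) le_rfl h1
      rwa [sin_pi_div_two] at this
    · rintro ⟨h0, h1⟩
      exact ⟨arcsin z, ⟨arcsin_pos.2 h0, arcsin_lt_pi_div_two.2 h1⟩,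
        sin_arcsin (by linarith) h1.le⟩
  have hinj : InjOn sin (Ioo 0 (π / 2)) := injOn_sin.mono
    (Ioo_subset_Icc_self.trans (Icc_subset_Icc_left (by linarith [pi_pos])))
  rw [integral_of_le zero_le_one, integral_of_le (by positivity), integral_Ioc_eq_integral_Ioo,
    integral_Ioc_eq_integral_Ioo, ← himage, integral_image_eq_integral_abs_deriv_smul
      measurableSet_Ioo (fun t _ => (hasDerivAt_sin t).hasDerivWithinAt) hinj]
  refine setIntegral_congr_fun measurableSet_Ioo fun t ht => ?_
  have : 0 < cos t := cos_pos_of_mem_Ioo ⟨by linarith [ht.1, pi_pos], ht.2⟩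
  simp [abs_of_pos this]

/-- Integrands over the quarter period need only agree where the cosine is positive. -/
lemma cos_mul_integral_congr {g h : ℝ → ℝ} (H : ∀ t, 0 < cos t → cos t * g t = h t) :
    ∫ t in (0:ℝ)..(π / 2), cos t * g t = ∫ t in (0:ℝ)..(π / 2), h t := by
  rw [integral_of_le (by positivity), integral_of_le (by positivity), integral_Ioc_eq_integral_Ioo,
    integral_Ioc_eq_integral_Ioo]
  exact setIntegral_congr_fun measurableSet_Ioo fun t ht =>
    H t (cos_pos_of_mem_Ioo ⟨by linarith [ht.1, pi_pos], ht.2⟩)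

lemma sqrt_one_sub_sin_sq {t : ℝ} (ht : 0 < cos t) : √(1 - sin t ^ 2) = cos t := by
  rw [← cos_sq', sqrt_sq ht.le]

lemma Pic_eq_integral_sin (n k : ℝ) :
    Pic n k = ∫ t in (0:ℝ)..(π / 2), 1 / ((1 - n * sin t ^ 2) * √(1 - k ^ 2 * sin t ^ 2)) := by
  rw [Pic, integral_zero_one_eq_integral_sin]
  refine cos_mul_integral_congr fun t ht => ?_
  rw [sqrt_mul (by rw [← cos_sq']; positivity), sqrt_one_sub_sin_sq ht,
    show (1 - n * sin t ^ 2) * (cos t * √(1 - k ^ 2 * sin t ^ 2))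
      = cos t * ((1 - n * sin t ^ 2) * √(1 - k ^ 2 * sin t ^ 2)) by ring,
    one_div, mul_inv, mul_inv_cancel_left₀ ht.ne', one_div]

lemma Kc_eq_Pic_zero (k : ℝ) : Kc k = Pic 0 k := by
  simp [Kc, Pic]

lemma Kc_eq_integral_sin (k : ℝ) :
    Kc k = ∫ t in (0:ℝ)..(π / 2), 1 / √(1 - k ^ 2 * sin t ^ 2) := by
  rw [Kc_eq_Pic_zero, Pic_eq_integral_sin]
  simp

lemma Ec_eq_integral_sin (k : ℝ) :
    Ec k = ∫ t in (0:ℝ)..(π / 2), √(1 - k ^ 2 * sin t ^ 2) := by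
  rw [Ec, integral_zero_one_eq_integral_sin]
  refine cos_mul_integral_congr fun t ht => ?_
  rw [sqrt_one_sub_sin_sq ht, mul_div_cancel₀ _ ht.ne']

lemma one_sub_mul_sin_sq_pos {m : ℝ} (hm : m < 1) (t : ℝ) : 0 < 1 - m * sin t ^ 2 := by
  rcases (sq_nonneg (sin t)).eq_or_lt with h | h
  · simp [← h]
  · nlinarith [sin_sq_le_one t]

/-- The open domain of admissible parameters `(n, k)`. -/
def ellipticDomain : Set (ℝ × ℝ) := Iio 1 ×ˢ Ioo (-1) 1

lemma isOpen_ellipticDomain : IsOpen ellipticDomain := isOpen_Iio.prod isOpen_Ioo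

lemma sq_lt_one_of_mem_Ioo {k : ℝ} (hk : k ∈ Ioo (-1 : ℝ) 1) : k ^ 2 < 1 := by
  nlinarith [hk.1, hk.2]

lemma hasFDerivAt_one_sub_sq_mul (k : ℝ × ℝ) (c : ℝ) :
    HasFDerivAt (fun x : ℝ × ℝ => 1 - x.2 ^ 2 * c)
      (-(2 * k.2 * c) • ContinuousLinearMap.snd ℝ ℝ ℝ) k := by
  refine (((hasFDerivAt_snd (p := k)).pow 2).mul_const c |>.const_sub 1).congr_fderiv ?_
  ext <;> simp
  ring

lemma hasDerivAt_Pic_curve {n : ℝ → ℝ} {n' k : ℝ} (hn : HasDerivAt n n' k) (hn1 : n k < 1)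
    (hk : k ∈ Ioo (-1 : ℝ) 1) :
    HasDerivAt (fun k => Pic (n k) k)
      (∫ t in (0:ℝ)..(π / 2),
        (sin t ^ 2 / ((1 - n k * sin t ^ 2) ^ 2 * √(1 - k ^ 2 * sin t ^ 2)) * n'
        + k * sin t ^ 2 / ((1 - n k * sin t ^ 2) * √(1 - k ^ 2 * sin t ^ 2) ^ 3))) k := by
  simp_rw [Pic_eq_integral_sin]
  have hD : ∀ y ∈ ellipticDomain ×ˢ (univ : Set ℝ), 1 - y.1.1 * sin y.2 ^ 2 ≠ 0 :=
    fun y hy => (one_sub_mul_sin_sq_pos hy.1.1 _).ne'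
  have hΔ : ∀ y ∈ ellipticDomain ×ˢ (univ : Set ℝ), √(1 - y.1.2 ^ 2 * sin y.2 ^ 2) ≠ 0 :=
    fun y hy => (sqrt_pos.2 (one_sub_mul_sin_sq_pos (sq_lt_one_of_mem_Ioo hy.1.2) _)).ne'
  refine hasDerivAt_intervalIntegral_curve isOpen_ellipticDomain
    (f := fun x t => 1 / ((1 - x.1 * sin t ^ 2) * √(1 - x.2 ^ 2 * sin t ^ 2)))
    (f₁ := fun x t => sin t ^ 2 / ((1 - x.1 * sin t ^ 2) ^ 2 * √(1 - x.2 ^ 2 * sin t ^ 2)))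
    (f₂ := fun x t => x.2 * sin t ^ 2 / ((1 - x.1 * sin t ^ 2) * √(1 - x.2 ^ 2 * sin t ^ 2) ^ 3))
    ?_ ?_ ?_ ?_ hn ⟨hn1, hk⟩
  · exact ContinuousOn.div (by fun_prop) (by fun_prop) fun y hy => mul_ne_zero (hD y hy) (hΔ y hy)
  · exact ContinuousOn.div (by fun_prop) (by fun_prop)
      fun y hy => mul_ne_zero (pow_ne_zero _ (hD y hy)) (hΔ y hy)
  · exact ContinuousOn.div (by fun_prop) (by fun_prop)
      fun y hy => mul_ne_zero (hD y hy) (pow_ne_zero _ (hΔ y hy))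
  · intro x hx t
    have hDx := hD (x, t) ⟨hx, mem_univ t⟩
    have hΔx := hΔ (x, t) ⟨hx, mem_univ t⟩
    have hΔpos := one_sub_mul_sin_sq_pos (sq_lt_one_of_mem_Ioo hx.2) t
    dsimp only at hDx hΔx
    have h₁ : HasFDerivAt (fun x : ℝ × ℝ => 1 - x.1 * sin t ^ 2)
        (-(sin t ^ 2) • ContinuousLinearMap.fst ℝ ℝ ℝ) x := by
      refine ((hasFDerivAt_fst (p := x)).mul_const (sin t ^ 2) |>.const_sub 1).congr_fderiv ?_
      ext <;> simp
    have h₂ := (hasFDerivAt_one_sub_sq_mul x (sin t ^ 2)).sqrt hΔpos.ne'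
    have h := (hasDerivAt_inv (mul_ne_zero hDx hΔx)).comp_hasFDerivAt x (h₁.mul h₂)
    simp only [one_div]
    refine h.congr_fderiv ?_
    ext <;> simp <;> field_simp

lemma hasDerivAt_Ec_integral {k : ℝ} (hk : k ∈ Ioo (-1 : ℝ) 1) :
    HasDerivAt Ec (∫ t in (0:ℝ)..(π / 2), -(k * sin t ^ 2) / √(1 - k ^ 2 * sin t ^ 2)) k := by
  rw [funext Ec_eq_integral_sin]
  have hΔ : ∀ y ∈ ellipticDomain ×ˢ (univ : Set ℝ), √(1 - y.1.2 ^ 2 * sin y.2 ^ 2) ≠ 0 :=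
    fun y hy => (sqrt_pos.2 (one_sub_mul_sin_sq_pos (sq_lt_one_of_mem_Ioo hy.1.2) _)).ne'
  have key := hasDerivAt_intervalIntegral_curve isOpen_ellipticDomain (a := 0) (b := π / 2)
    (f := fun x t => √(1 - x.2 ^ 2 * sin t ^ 2)) (f₁ := fun _ _ => 0)
    (f₂ := fun x t => -(x.2 * sin t ^ 2) / √(1 - x.2 ^ 2 * sin t ^ 2))
    (by fun_prop) (by fun_prop) (ContinuousOn.div (by fun_prop) (by fun_prop) hΔ) ?_
    (hasDerivAt_const k (0:ℝ)) ⟨mem_Iio.2 zero_lt_one, hk⟩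
  · simpa using key
  · intro x hx t
    have hΔpos := one_sub_mul_sin_sq_pos (sq_lt_one_of_mem_Ioo hx.2) t
    refine ((hasFDerivAt_one_sub_sq_mul x (sin t ^ 2)).sqrt hΔpos.ne').congr_fderiv ?_
    ext <;> simp
    field_simp

lemma continuous_sqrt_elliptic (k : ℝ) : Continuous fun t => √(1 - k ^ 2 * sin t ^ 2) := by
  fun_prop

lemma sqrt_elliptic_pos {k : ℝ} (hk : k ∈ Ioo (-1 : ℝ) 1) (t : ℝ) :
    0 < √(1 - k ^ 2 * sin t ^ 2) :=
  sqrt_pos.2 (one_sub_mul_sin_sq_pos (sq_lt_one_of_mem_Ioo hk) t)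

lemma hasDerivAt_sqrt_elliptic {k : ℝ} (hk : k ∈ Ioo (-1 : ℝ) 1) (t : ℝ) :
    HasDerivAt (fun t => √(1 - k ^ 2 * sin t ^ 2))
      (-(k ^ 2 * sin t * cos t) / √(1 - k ^ 2 * sin t ^ 2)) t := by
  have h := ((((hasDerivAt_sin t).pow 2).const_mul (k ^ 2)).const_sub 1).sqrt
    (one_sub_mul_sin_sq_pos (sq_lt_one_of_mem_Ioo hk) t).ne'
  refine h.congr_deriv ?_
  have := sqrt_elliptic_pos hk t
  simp only [Pi.pow_apply]
  field_simp
  ring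

/-- The third-power integral expressed by `Ec`. -/
lemma integral_inv_sqrt_cube {k : ℝ} (hk : k ∈ Ioo (-1 : ℝ) 1) :
    (1 - k ^ 2) * ∫ t in (0:ℝ)..(π / 2), 1 / √(1 - k ^ 2 * sin t ^ 2) ^ 3 = Ec k := by
  have hpos := sqrt_elliptic_pos hk
  have hder : ∀ t ∈ uIcc 0 (π / 2), HasDerivAt
      (fun t => k ^ 2 * (sin t * cos t / √(1 - k ^ 2 * sin t ^ 2)))
      (√(1 - k ^ 2 * sin t ^ 2) - (1 - k ^ 2) * (1 / √(1 - k ^ 2 * sin t ^ 2) ^ 3)) t := by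
    intro t _
    have h := (((hasDerivAt_sin t).mul (hasDerivAt_cos t)).div (hasDerivAt_sqrt_elliptic hk t)
      (hpos t).ne').const_mul (k ^ 2)
    refine h.congr_deriv ?_
    have hs : √(1 - k ^ 2 * sin t ^ 2) ^ 2 = 1 - k ^ 2 * sin t ^ 2 :=
      sq_sqrt (one_sub_mul_sin_sq_pos (sq_lt_one_of_mem_Ioo hk) t).le
    have hc := cos_sq' t
    have := hpos t
    simp only [Pi.mul_apply]
    generalize √(1 - k ^ 2 * sin t ^ 2) = w at *
    field_simp
    grind
  have hc₁ : Continuous fun t => (1 - k ^ 2) * (1 / √(1 - k ^ 2 * sin t ^ 2) ^ 3) :=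
    continuous_const.mul (continuous_const.div (by fun_prop) fun t => (pow_pos (hpos t) 3).ne')
  have hc₂ := continuous_sqrt_elliptic k
  have h := integral_eq_sub_of_hasDerivAt hder ((hc₂.sub hc₁).intervalIntegrable _ _)
  rw [integral_sub (hc₂.intervalIntegrable _ _) (hc₁.intervalIntegrable _ _),
    intervalIntegral.integral_const_mul, ← Ec_eq_integral_sin] at h
  simp at h
  simp
  linarith

lemma hasDerivAt_Ec {k : ℝ} (hk : k ∈ Ioo (-1 : ℝ) 1) (hk0 : k ≠ 0) :
    HasDerivAt Ec ((Ec k - Kc k) / k) k := by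
  have hpos := sqrt_elliptic_pos hk
  have hc := continuous_sqrt_elliptic k
  have hc' : Continuous fun t => 1 / √(1 - k ^ 2 * sin t ^ 2) :=
    continuous_const.div hc fun t => (hpos t).ne'
  refine (hasDerivAt_Ec_integral hk).congr_deriv ?_
  rw [Ec_eq_integral_sin, Kc_eq_integral_sin,
    ← integral_sub (hc.intervalIntegrable _ _) (hc'.intervalIntegrable _ _),
    ← intervalIntegral.integral_div]
  refine integral_congr fun t _ => ?_
  have hs : √(1 - k ^ 2 * sin t ^ 2) ^ 2 = 1 - k ^ 2 * sin t ^ 2 :=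
    sq_sqrt (one_sub_mul_sin_sq_pos (sq_lt_one_of_mem_Ioo hk) t).le
  have := hpos t
  generalize √(1 - k ^ 2 * sin t ^ 2) = w at *
  field_simp
  linarith

/-- The modulus derivative of the third-kind integrand expressed by `Pic` and `Ec`. -/
lemma integral_modulus_deriv {n k : ℝ} (hn : n < 1) (hk : k ∈ Ioo (-1 : ℝ) 1) (hnk : n ≠ k ^ 2) :
    ∫ t in (0:ℝ)..(π / 2),
      k * sin t ^ 2 / ((1 - n * sin t ^ 2) * √(1 - k ^ 2 * sin t ^ 2) ^ 3)
      = k / (n - k ^ 2) * (Pic n k - Ec k / (1 - k ^ 2)) := by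
  have hpos := sqrt_elliptic_pos hk
  have hD := one_sub_mul_sin_sq_pos hn
  have hnk' : n - k ^ 2 ≠ 0 := sub_ne_zero.2 hnk
  have hk1 : 1 - k ^ 2 ≠ 0 := (sub_pos.2 (sq_lt_one_of_mem_Ioo hk)).ne'
  have hc₁ : Continuous fun t => 1 / ((1 - n * sin t ^ 2) * √(1 - k ^ 2 * sin t ^ 2)) :=
    continuous_const.div (by fun_prop) fun t => (mul_pos (hD t) (hpos t)).ne'
  have hc₂ : Continuous fun t => 1 / √(1 - k ^ 2 * sin t ^ 2) ^ 3 :=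
    continuous_const.div (by fun_prop) fun t => (pow_pos (hpos t) 3).ne'
  rw [← integral_inv_sqrt_cube hk, mul_div_cancel_left₀ _ hk1, Pic_eq_integral_sin,
    ← integral_sub (hc₁.intervalIntegrable _ _) (hc₂.intervalIntegrable _ _),
    ← intervalIntegral.integral_const_mul]
  refine integral_congr fun t _ => ?_
  have hs : √(1 - k ^ 2 * sin t ^ 2) ^ 2 = 1 - k ^ 2 * sin t ^ 2 :=
    sq_sqrt (one_sub_mul_sin_sq_pos (sq_lt_one_of_mem_Ioo hk) t).le
  have := hpos t
  have hDt := hD t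
  generalize √(1 - k ^ 2 * sin t ^ 2) = w at *
  generalize hDeq : 1 - n * sin t ^ 2 = D at *
  field_simp
  rw [hs, ← hDeq]
  ring

/-- The characteristic derivative of the third-kind integrand expressed by `Ec`, `Kc`, `Pic`. -/
lemma integral_characteristic_deriv {n k : ℝ} (hn : n < 1) (hk : k ∈ Ioo (-1 : ℝ) 1) :
    2 * n * (k ^ 2 - n) * (n - 1) * ∫ t in (0:ℝ)..(π / 2),
      sin t ^ 2 / ((1 - n * sin t ^ 2) ^ 2 * √(1 - k ^ 2 * sin t ^ 2))
      = n * Ec k + (k ^ 2 - n) * Kc k + (n ^ 2 - k ^ 2) * Pic n k := by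
  have hpos := sqrt_elliptic_pos hk
  have hD := one_sub_mul_sin_sq_pos hn
  have hc₀ : Continuous fun t => 2 * n * (k ^ 2 - n) * (n - 1) *
      (sin t ^ 2 / ((1 - n * sin t ^ 2) ^ 2 * √(1 - k ^ 2 * sin t ^ 2))) :=
    continuous_const.mul ((by fun_prop : Continuous fun t => sin t ^ 2).div (by fun_prop)
      fun t => (mul_pos (pow_pos (hD t) 2) (hpos t)).ne')
  have hc₁ : Continuous fun t => n * √(1 - k ^ 2 * sin t ^ 2) := by fun_prop
  have hc₂ : Continuous fun t => (k ^ 2 - n) * (1 / √(1 - k ^ 2 * sin t ^ 2)) :=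
    continuous_const.mul (continuous_const.div (by fun_prop) fun t => (hpos t).ne')
  have hc₃ : Continuous fun t =>
      (n ^ 2 - k ^ 2) * (1 / ((1 - n * sin t ^ 2) * √(1 - k ^ 2 * sin t ^ 2))) :=
    continuous_const.mul
      (continuous_const.div (by fun_prop) fun t => (mul_pos (hD t) (hpos t)).ne')
  have hder : ∀ t ∈ uIcc 0 (π / 2), HasDerivAt
      (fun t => -n ^ 2 * (sin t * cos t * √(1 - k ^ 2 * sin t ^ 2) / (1 - n * sin t ^ 2)))
      (2 * n * (k ^ 2 - n) * (n - 1) *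
        (sin t ^ 2 / ((1 - n * sin t ^ 2) ^ 2 * √(1 - k ^ 2 * sin t ^ 2)))
        - (n * √(1 - k ^ 2 * sin t ^ 2) + (k ^ 2 - n) * (1 / √(1 - k ^ 2 * sin t ^ 2))
          + (n ^ 2 - k ^ 2) *
            (1 / ((1 - n * sin t ^ 2) * √(1 - k ^ 2 * sin t ^ 2))))) t := by
    intro t _
    have h := ((((hasDerivAt_sin t).mul (hasDerivAt_cos t)).mul
      (hasDerivAt_sqrt_elliptic hk t)).div
      ((((hasDerivAt_sin t).pow 2).const_mul n).const_sub 1) (hD t).ne').const_mul (-n ^ 2)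
    refine h.congr_deriv ?_
    have hs : √(1 - k ^ 2 * sin t ^ 2) ^ 2 = 1 - k ^ 2 * sin t ^ 2 :=
      sq_sqrt (one_sub_mul_sin_sq_pos (sq_lt_one_of_mem_Ioo hk) t).le
    have hc := cos_sq' t
    have := hpos t
    have := hD t
    simp only [Pi.mul_apply, Pi.pow_apply]
    generalize √(1 - k ^ 2 * sin t ^ 2) = w at *
    field_simp
    rw [hs]
    ring_nf
    rw [hc]
    ring
  have h := integral_eq_sub_of_hasDerivAt hder
    ((hc₀.sub ((hc₁.add hc₂).add hc₃)).intervalIntegrable _ _)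
  rw [integral_sub (hc₀.intervalIntegrable _ _)
      ((hc₁.fun_add hc₂).fun_add hc₃ |>.intervalIntegrable _ _),
    integral_add ((hc₁.fun_add hc₂).intervalIntegrable _ _) (hc₃.intervalIntegrable _ _),
    integral_add (hc₁.intervalIntegrable _ _) (hc₂.intervalIntegrable _ _)] at h
  simp only [intervalIntegral.integral_const_mul] at h
  rw [← Ec_eq_integral_sin, ← Kc_eq_integral_sin, ← Pic_eq_integral_sin] at h
  simp only [cos_pi_div_two, sin_zero, mul_zero, zero_mul, zero_div, sub_zero] at h
  linarith

lemma hasDerivAt_Pic {n : ℝ → ℝ} {n' k : ℝ} (hn : HasDerivAt n n' k) (hn1 : n k < 1)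
    (hk : k ∈ Ioo (-1 : ℝ) 1) (hnk : n k ≠ k ^ 2) :
    HasDerivAt (fun k => Pic (n k) k)
      ((∫ t in (0:ℝ)..(π / 2),
        sin t ^ 2 / ((1 - n k * sin t ^ 2) ^ 2 * √(1 - k ^ 2 * sin t ^ 2))) * n'
        + k / (n k - k ^ 2) * (Pic (n k) k - Ec k / (1 - k ^ 2))) k := by
  have hpos := sqrt_elliptic_pos hk
  have hD := one_sub_mul_sin_sq_pos hn1
  refine (hasDerivAt_Pic_curve hn hn1 hk).congr_deriv ?_
  rw [intervalIntegral.integral_add, intervalIntegral.integral_mul_const, integral_modulus_deriv hn1 hk hnk]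
  · exact Continuous.intervalIntegrable (Continuous.mul (Continuous.div (by fun_prop)
      (by fun_prop) fun t => (mul_pos (pow_pos (hD t) 2) (hpos t)).ne') continuous_const) _ _
  · exact Continuous.intervalIntegrable (Continuous.div (by fun_prop)
      (by fun_prop) fun t => (mul_pos (hD t) (pow_pos (hpos t) 3)).ne') _ _

lemma hasDerivAt_Kc {k : ℝ} (hk : k ∈ Ioo (-1 : ℝ) 1) (hk0 : k ≠ 0) :
    HasDerivAt Kc (Ec k / (k * (1 - k ^ 2)) - Kc k / k) k := by
  have h := hasDerivAt_Pic (hasDerivAt_const k (0:ℝ)) zero_lt_one hk (pow_ne_zero 2 hk0).symm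
  simp only [← Kc_eq_Pic_zero] at h
  refine h.congr_deriv ?_
  have hk1 : 1 - k ^ 2 ≠ 0 := (sub_pos.2 (sq_lt_one_of_mem_Ioo hk)).ne'
  field_simp
  ring

/-- Theorem 1.2 of the paper: elimination of the third-kind integral.
Here `p', q', r', μ', X'` denote the derivative functions of `p, q, r, μ, X`. -/
theorem melnikov_reduction
    (p p' q q' r r' μ μ' X X' : ℝ → ℝ)
    (hp : ∀ k ∈ Set.Ioo (-1 : ℝ) 1, HasDerivAt p (p' k) k)
    (hq : ∀ k ∈ Set.Ioo (-1 : ℝ) 1, HasDerivAt q (q' k) k)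
    (hr : ∀ k ∈ Set.Ioo (-1 : ℝ) 1, HasDerivAt r (r' k) k)
    (hμ : ∀ k ∈ Set.Ioo (-1 : ℝ) 1, HasDerivAt μ (μ' k) k)
    (hX : ∀ k ∈ Set.Ioo (-1 : ℝ) 1, HasDerivAt X (X' k) k)
    (hμrange : ∀ k ∈ Set.Ioo (-1 : ℝ) 1, μ k ∈ Set.Ioo (0 : ℝ) 1)
    (hμne : ∀ k ∈ Set.Ioo (-1 : ℝ) 1, μ k ≠ k ^ 2)
    (hXpos : ∀ k ∈ Set.Ioo (-1 : ℝ) 1, 0 < X k)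
    (hX' : ∀ k ∈ Set.Ioo (-1 : ℝ) 1,
      X' k = (k / (k ^ 2 - μ k)
        + ((μ k) ^ 2 - k ^ 2) * μ' k / (2 * μ k * (1 - μ k) * (k ^ 2 - μ k))) * X k) :
    ∀ k ∈ Set.Ioo (-1 : ℝ) 1, k ≠ 0 → r k ≠ 0 →
      r k ^ 2 *
        deriv (fun k => (p k * Kc k + q k * Ec k + r k * Pic (μ k) k) * X k / r k) k
      = ((p' k * r k - p k * r' k) * X k + p k * r k * X' k
          - (p k + q k) * r k * X k / k
          + (-(μ' k) / (2 * μ k * (1 - μ k))) * r k ^ 2 * X k) * Kc k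
        + ((q' k * r k - q k * r' k) * X k + q k * r k * X' k
            + p k * r k * X k / (k * (1 - k ^ 2)) + q k * r k * X k / k
            + (k / ((μ k - k ^ 2) * (k ^ 2 - 1))
                + μ' k / (2 * (1 - μ k) * (μ k - k ^ 2))) * r k ^ 2 * X k) * Ec k := by
  intro k hk hk0 hr0
  obtain ⟨hμ0, hμ1⟩ := hμrange k hk
  have hnk := hμne k hk
  have hk1 : 1 - k ^ 2 ≠ 0 := (sub_pos.2 (sq_lt_one_of_mem_Ioo hk)).ne'
  have hμ1' : 1 - μ k ≠ 0 := (sub_pos.2 hμ1).ne'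
  have hnk₁ : μ k - k ^ 2 ≠ 0 := sub_ne_zero.2 hnk
  have hnk₂ : k ^ 2 - μ k ≠ 0 := sub_ne_zero.2 hnk.symm
  have hI := ((((hp k hk).mul (hasDerivAt_Kc hk hk0)).add
    ((hq k hk).mul (hasDerivAt_Ec hk hk0))).add
    ((hr k hk).mul (hasDerivAt_Pic (hμ k hk) hμ1 hk hnk)))
  have h := (hI.mul (hX k hk)).div (hr k hk) hr0
  have hchar := integral_characteristic_deriv hμ1 hk
  set A := ∫ t in (0:ℝ)..(π / 2),
    sin t ^ 2 / ((1 - μ k * sin t ^ 2) ^ 2 * √(1 - k ^ 2 * sin t ^ 2))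
  have hA : A = -(μ k * Ec k + (k ^ 2 - μ k) * Kc k + (μ k ^ 2 - k ^ 2) * Pic (μ k) k)
      / (2 * μ k * (k ^ 2 - μ k) * (1 - μ k)) := by
    rw [eq_div_iff (by positivity)]
    linarith
  refine (congrArg (r k ^ 2 * ·) h.deriv).trans ?_
  simp only [Pi.add_apply, Pi.mul_apply]
  rw [hA, hX' k hk, ← neg_sub (μ k) (k ^ 2), ← neg_sub 1 (k ^ 2)]
  field_simp
  ring
end
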